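/- arXiv:2501.01479 — 12 statements merged into one kernel-verified Lean document; each statement's English description precedes it below -/
import Mathlib

section
/- Let [a,b] ⊂ ℝ with a < b and let M = (M_n)_{n∈ℕ} be a sequence of positive real numbers with M_0 = 1. If liminf_{n→∞} M_n^{1/n} < ∞, then the class C_M([a,b]) is quasianalytic in the sense of Denjoy–Carleman. -/
open Set Filter

/-- `f` belongs to the Denjoy–Carleman class `C_M([a,b])`. -/
def DenjoyCarlemanClass (M : ℕ → ℝ) (a b : ℝ) (f : ℝ → ℝ) : Prop :=
  ContDiffOn ℝ (⊤ : ℕ∞) f (Set.Icc a b) ∧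
  ∃ k > (0 : ℝ), ∃ C > (0 : ℝ), ∀ n : ℕ, ∀ x ∈ Set.Icc a b,
    |iteratedDerivWithin n f (Set.Icc a b) x| ≤ k * C ^ n * M n

/-- Iterated mean value inequality from a point where all functions of the chain vanish. -/
lemma chain_bound (s : Set ℝ) (hs : Convex ℝ s) (g : ℕ → ℝ → ℝ)
    (hg : ∀ m, ∀ x ∈ s, HasDerivWithinAt (g m) (g (m + 1) x) s x)
    (c : ℝ) (hc : c ∈ s) (hz : ∀ m, g m c = 0) (B : ℝ) (hB : 0 ≤ B) (j : ℕ) :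
    ∀ m, (∀ y ∈ s, |g (m + j) y| ≤ B) → ∀ x ∈ s, |g m x| ≤ B * |x - c| ^ j := by
  induction j with
  | zero => intro m h x hx; simpa using h x hx
  | succ j ih =>
    intro m h x hx
    have h1 := ih (m + 1) (by
      intro y hy
      have := h y hy
      rwa [show m + (j + 1) = m + 1 + j by ring] at this)
    have hsub : uIcc c x ⊆ s := by
      rw [← segment_eq_uIcc]; exact hs.segment_subset hc hx
    have h2 := Convex.norm_image_sub_le_of_norm_hasDerivWithin_le (f := g m) (f' := g (m + 1))
      (s := uIcc c x) (C := B * |x - c| ^ j) (x := c) (y := x)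
      (fun y hy => (hg m y (hsub hy)).mono hsub)
      (fun y hy => (h1 y (hsub hy)).trans (by
        have := abs_sub_left_of_mem_uIcc hy
        gcongr))
      (convex_uIcc c x) left_mem_uIcc right_mem_uIcc
    rw [hz m, sub_zero, Real.norm_eq_abs, Real.norm_eq_abs] at h2
    calc |g m x| ≤ _ := h2
      _ = _ := by ring

/-- If `liminf_{n→∞} M_n^{1/n} < ∞`, then the class `C_M([a,b])` is quasianalytic in the
sense of Denjoy–Carleman. -/
theorem quasianalytic_of_liminf_lt_top
    (a b : ℝ) (hab : a < b) (M : ℕ → ℝ) (hMpos : ∀ n, 0 < M n) (hM0 : M 0 = 1)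
    (hliminf : Filter.liminf (fun n : ℕ => ENNReal.ofReal (M n ^ ((n : ℝ)⁻¹)))
        Filter.atTop < ⊤) :
    ∀ f : ℝ → ℝ, DenjoyCarlemanClass M a b f →
      (∃ c ∈ Set.Icc a b, ∀ n : ℕ, iteratedDerivWithin n f (Set.Icc a b) c = 0) →
      ∀ x ∈ Set.Icc a b, f x = 0 := by
  rintro f ⟨hf, k, hk, C, hC, hbd⟩ ⟨c, hc, hz⟩
  obtain ⟨R, hR, hfreq⟩ : ∃ R > (0 : ℝ), ∃ᶠ n in atTop, M n ≤ R ^ n := by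
    obtain ⟨r, hr1, hr2⟩ := ENNReal.lt_iff_exists_nnreal_btwn.1 hliminf
    have h := frequently_lt_of_liminf_lt (h := hr1)
    refine ⟨r + 1, by positivity, ?_⟩
    refine (h.and_eventually (eventually_gt_atTop 0)).mono ?_
    rintro n ⟨hn, hn0⟩
    have hpos : 0 ≤ M n ^ ((n : ℝ)⁻¹) := Real.rpow_nonneg (hMpos n).le _
    have h1 : M n ^ ((n : ℝ)⁻¹) ≤ r + 1 := by
      have h2 : ENNReal.ofReal (M n ^ ((n : ℝ)⁻¹)) ≤ ENNReal.ofReal r := by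
        rw [ENNReal.ofReal_coe_nnreal]; exact hn.le
      have := (ENNReal.ofReal_le_ofReal_iff r.coe_nonneg).1 h2
      linarith
    calc M n = (M n ^ ((n : ℝ)⁻¹)) ^ n := (Real.rpow_inv_natCast_pow (hMpos n).le hn0.ne').symm
      _ ≤ _ := pow_le_pow_left₀ hpos h1 n
  set s := Icc a b with hs
  have hcv : Convex ℝ s := convex_Icc a b
  have hg : ∀ m, ∀ x ∈ s, HasDerivWithinAt (iteratedDerivWithin m f s)
      (iteratedDerivWithin (m + 1) f s x) s x := by
    intro m x hx
    rw [iteratedDerivWithin_succ]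
    exact (hf.differentiableOn_iteratedDerivWithin
      (by exact_mod_cast ENat.natCast_lt_top m) (uniqueDiffOn_Icc hab) x hx).hasDerivWithinAt
  obtain ⟨δ, hδ, hδe⟩ : ∃ δ > (0 : ℝ), C * R * δ = 1 / 2 :=
    ⟨1 / 2 / (C * R), by positivity, by field_simp⟩
  -- local vanishing with uniform radius
  have hloc : ∀ c ∈ s, (∀ m, iteratedDerivWithin m f s c = 0) → ∀ x ∈ s, |x - c| ≤ δ →
      ∀ m, iteratedDerivWithin m f s x = 0 := by
    intro c hc hz x hx hxc m
    have hfr : ∃ᶠ n : ℕ in atTop,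
        |iteratedDerivWithin m f s x| ≤ k / δ ^ m * (1 / 2) ^ n := by
      refine (hfreq.and_eventually (eventually_ge_atTop m)).mono ?_
      rintro n ⟨hn, hmn⟩
      obtain ⟨j, rfl⟩ := Nat.exists_eq_add_of_le hmn
      have h1 := chain_bound s hcv (fun m => iteratedDerivWithin m f s) hg c hc hz
        (k * C ^ (m + j) * R ^ (m + j)) (by positivity) j m
        (fun y hy => (hbd (m + j) y hy).trans (by gcongr)) x hx
      calc _ ≤ _ := h1
        _ ≤ k * C ^ (m + j) * R ^ (m + j) * δ ^ j := by gcongr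
        _ = _ := by
          rw [← hδe]
          field_simp
          ring
    have ht : Tendsto (fun n : ℕ => k / δ ^ m * (1 / 2 : ℝ) ^ n) atTop (nhds 0) := by
      simpa using (tendsto_pow_atTop_nhds_zero_of_lt_one (r := (1 / 2 : ℝ))
        (by norm_num) (by norm_num)).const_mul (k / δ ^ m)
    have : |iteratedDerivWithin m f s x| ≤ 0 := by
      by_contra! hcon
      obtain ⟨n, h1, h2⟩ := (hfr.and_eventually (ht.eventually_lt_const hcon)).exists
      linarith
    exact abs_eq_zero.1 (le_antisymm this (abs_nonneg _))
  have hN : ∀ N : ℕ, ∀ x ∈ s, |x - c| ≤ N * δ → ∀ m, iteratedDerivWithin m f s x = 0 := by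
    intro N
    induction N with
    | zero =>
      intro x hx h m
      have : x = c := by
        have : |x - c| ≤ 0 := by simpa using h
        linarith [abs_eq_zero.1 (le_antisymm this (abs_nonneg _))]
      rw [this]; exact hz m
    | succ N ih =>
      intro x hx h
      have hN1 : (0 : ℝ) < N + 1 := by positivity
      push_cast at h
      set y : ℝ := (1 / (N + 1 : ℝ)) * c + (N / (N + 1 : ℝ)) * x with hy
      have hys : y ∈ s := hcv hc hx (by positivity) (by positivity) (by field_simp; ring)
      have e1 : y - c = (N / (N + 1 : ℝ)) * (x - c) := by rw [hy]; field_simp; ring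
      have e2 : x - y = (1 / (N + 1 : ℝ)) * (x - c) := by rw [hy]; field_simp; ring
      refine hloc y hys (ih y hys ?_) x hx ?_
      · rw [e1, abs_mul, abs_of_nonneg (by positivity)]
        calc _ ≤ (N / (N + 1 : ℝ)) * ((N + 1) * δ) := by gcongr
          _ = _ := by field_simp
      · rw [e2, abs_mul, abs_of_nonneg (by positivity)]
        calc _ ≤ (1 / (N + 1 : ℝ)) * ((N + 1) * δ) := by gcongr
          _ = _ := by field_simp
  intro x hx
  obtain ⟨N, hNN⟩ := exists_nat_ge (|x - c| / δ)
  have := hN N x hx ((div_le_iff₀ hδ).1 hNN) 0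
  simpa using this
end

section
/- (Mandelbrojt.) Let M = (M_n)_{n∈ℕ} be a sequence of positive real numbers with M_0 = 1 and liminf_{n→∞} M_n^{1/n} = ∞, and let (M^c_n)_{n∈ℕ} denote its log-convex regularization. Then the following conditions are equivalent: (1) ∑_{n=1}^∞ 1/β_n = ∞, where β_n = inf_{k≥n} M_k^{1/k}; (2) ∑_{n=1}^∞ 1/(M^c_n)^{1/n} = ∞; (3) ∑_{n=1}^∞ M^c_{n-1}/M^c_n = ∞. -/
open Filter

/-- Carleman-type lemma for convex sequences. -/
lemma carleman_aux (c s : ℕ → ℝ) (hc0 : c 0 = 0) (hs : ∀ n, c (n+1) = c n + s n)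
    (hmono : Monotone s) (hsum : Summable (fun n => Real.exp (-s n))) :
    Summable (fun n : ℕ => Real.exp (-(c (n+1) / ((n:ℝ)+1)))) := by
  set G : ℕ → ℝ := fun n : ℕ => Real.exp (-(c (n+1) / ((n:ℝ)+1))) with hG
  have hGpos : ∀ n, 0 < G n := fun n => Real.exp_pos _
  have h1 : ∀ k : ℕ, c k ≤ k * s k := by
    intro k
    induction k with
    | zero => simp [hc0]
    | succ k ih =>
      have := hmono (Nat.le_succ k)
      rw [hs]; push_cast
      have hk : (0:ℝ) ≤ k := Nat.cast_nonneg k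
      simp only [Nat.succ_eq_add_one] at this
      nlinarith
  have hanti : ∀ n, G (n+1) ≤ G n := by
    intro n
    apply Real.exp_le_exp.2
    apply neg_le_neg
    have h := h1 (n+1)
    rw [hs (n+1)]
    have hn : (0:ℝ) < (n:ℝ)+1 := by positivity
    push_cast at h ⊢
    rw [div_le_div_iff₀ hn (by positivity)]
    nlinarith
  have h2 : ∀ N j : ℕ, c N + j * s N ≤ c (N + j) := by
    intro N j
    induction j with
    | zero => simp
    | succ j ih =>
      have := hmono (Nat.le_add_right N j)
      rw [← add_assoc, hs]; push_cast
      linarith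
  have hkey : ∀ n, G (2*n+1) ≤ G n / 4 + Real.exp (-s n) := by
    intro n
    have h := h2 (n+1) (n+1)
    have hm := hmono (Nat.le_succ n)
    simp only [Nat.succ_eq_add_one] at hm
    have hn : (0:ℝ) < (n:ℝ)+1 := by positivity
    push_cast at h
    have e : n + 1 + (n + 1) = 2*n+1+1 := by ring
    rw [e] at h
    have hle : (c (n+1) / ((n:ℝ)+1) + s n) / 2 ≤ c (2*n+1+1) / (((2*n+1 : ℕ):ℝ)+1) := by
      push_cast
      rw [le_div_iff₀ (by positivity)]
      have e2 : (c (n+1) / ((n:ℝ)+1) + s n) / 2 * (2 * (n:ℝ) + 1 + 1)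
        = c (n+1) + ((n:ℝ)+1) * s n := by field_simp; ring
      rw [e2]
      nlinarith
    have h3 : G (2*n+1) ≤ Real.exp (-(c (n+1) / ((n:ℝ)+1))/2) * Real.exp (-s n/2) := by
      rw [← Real.exp_add]
      apply Real.exp_le_exp.2
      linarith
    have h4 : G n = Real.exp (-(c (n+1) / ((n:ℝ)+1))/2) ^ 2 := by
      rw [← Real.exp_nat_mul]; simp only [hG]; congr 1; push_cast; ring
    have h5 : Real.exp (-s n) = Real.exp (-s n/2) ^ 2 := by
      rw [← Real.exp_nat_mul]; congr 1; push_cast; ring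
    rw [h4, h5]
    nlinarith [sq_nonneg (Real.exp (-(c (n+1) / ((n:ℝ)+1))/2) / 2 - Real.exp (-s n/2))]
  have hS : ∀ N : ℕ, ∑ i ∈ Finset.range (2*N+1), G i
      ≤ G 0 + (∑ i ∈ Finset.range N, G i) / 2 + 2 * ∑ i ∈ Finset.range N, Real.exp (-s i) := by
    intro N
    induction N with
    | zero => simp
    | succ N ih =>
      have e : 2*(N+1)+1 = 2*N+1+1+1 := by ring
      rw [e, Finset.sum_range_succ, Finset.sum_range_succ, Finset.sum_range_succ _ N,
        Finset.sum_range_succ _ N]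
      have := hkey N
      have := hanti (2*N+1)
      linarith
  refine summable_of_sum_range_le (c := 2 * G 0 + 4 * ∑' i, Real.exp (-s i))
    (fun n => (hGpos n).le) ?_
  intro N
  have hA : ∑ i ∈ Finset.range N, G i ≤ ∑ i ∈ Finset.range (2*N+1), G i :=
    Finset.sum_le_sum_of_subset_of_nonneg (Finset.range_mono (by omega))
      (fun i _ _ => (hGpos i).le)
  have hB : ∑ i ∈ Finset.range N, Real.exp (-s i) ≤ ∑' i, Real.exp (-s i) :=
    hsum.sum_le_tsum _ (fun i _ => (Real.exp_pos _).le)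
  have := hS N
  linarith

/-- Minimal slope from a given point. -/
lemma min_slope (a : ℕ → ℝ) (ha : Tendsto (fun n : ℕ => a n / (n:ℝ)) atTop atTop) (q : ℕ) :
    ∃ r : ℕ, q < r ∧ ∃ s : ℝ, a r = a q + s * ((r:ℝ) - q) ∧
      ∀ m : ℕ, q ≤ m → a q + s * ((m:ℝ) - q) ≤ a m := by
  have ht : Tendsto (fun j : ℕ => (a (j+(q+1)) - a q) / (((j+(q+1) : ℕ):ℝ) - q)) atTop atTop := by
    have h0 := (tendsto_add_atTop_iff_nat (q+1)).2 ha
    have h1 := tendsto_atTop_add_const_right atTop (-|a q|) h0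
    refine tendsto_atTop_mono' _ ?_ h1
    filter_upwards [h0.eventually_ge_atTop 0] with j hj
    push_cast at hj ⊢
    have hp : (0:ℝ) < (j:ℝ) + (q+1) := by positivity
    have hj0 : (0:ℝ) ≤ j := Nat.cast_nonneg j
    have hq0 : (0:ℝ) ≤ q := Nat.cast_nonneg q
    set x := a (j+(q+1)) / ((j:ℝ)+(q+1)) with hx
    have hx' : a (j+(q+1)) = x * ((j:ℝ)+(q+1)) := by rw [hx]; field_simp
    rw [hx', le_div_iff₀ (by linarith)]
    have := le_abs_self (a q)
    have := abs_nonneg (a q)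
    nlinarith [mul_nonneg hj hq0, mul_nonneg this hj0]
  rw [← Nat.cofinite_eq_atTop] at ht
  obtain ⟨j, hj⟩ := ht.exists_forall_le
  refine ⟨j+(q+1), by omega, (a (j+(q+1)) - a q) / (((j+(q+1) : ℕ):ℝ) - q), ?_, ?_⟩
  · have : (((j+(q+1) : ℕ):ℝ) - q) ≠ 0 := by
      push_cast
      have hj0 : (0:ℝ) ≤ j := Nat.cast_nonneg j
      have : (j:ℝ) + (q+1) - q = j + 1 := by ring
      rw [this]; positivity
    field_simp
    ring
  · intro m hm
    rcases hm.eq_or_lt with rfl | hm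
    · simp
    · have h := hj (m - (q+1))
      rw [Nat.sub_add_cancel hm] at h
      have hp : (0:ℝ) < (m:ℝ) - q := sub_pos.2 (by exact_mod_cast hm)
      rw [le_div_iff₀ hp] at h
      linarith

lemma exists_line (a : ℕ → ℝ) (ha : Tendsto (fun n : ℕ => a n / (n:ℝ)) atTop atTop) (n : ℕ) :
    ∃ (p q : ℕ) (s : ℝ), p ≤ n ∧ n < q ∧ a q = a p + s * ((q:ℝ) - p) ∧
      ∀ m : ℕ, a p + s * ((m:ℝ) - p) ≤ a m := by
  induction n with
  | zero =>
    obtain ⟨r, hr, s, h1, h2⟩ := min_slope a ha 0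
    exact ⟨0, r, s, le_rfl, hr, h1, fun m => h2 m (Nat.zero_le _)⟩
  | succ n ih =>
    obtain ⟨p, q, s, hp, hq, h1, h2⟩ := ih
    by_cases hlt : n + 1 < q
    · exact ⟨p, q, s, by omega, hlt, h1, h2⟩
    · have hqe : q = n + 1 := by omega
      obtain ⟨r, hr, t, h3, h4⟩ := min_slope a ha q
      refine ⟨q, r, t, hqe.le, by omega, h3, fun m => ?_⟩
      rcases le_total q m with hm | hm
      · exact h4 m hm
      · have hst : s ≤ t := by
          have hr' : (0:ℝ) < (r:ℝ) - q := sub_pos.2 (by exact_mod_cast hr)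
          have := h2 r
          by_contra hcon
          push Not at hcon
          nlinarith
        have hm' : (m:ℝ) ≤ q := by exact_mod_cast hm
        have := h2 m
        nlinarith

/-- Mandelbrojt's theorem: for a sequence `M` of positive reals with `M 0 = 1` and
`liminf M_n^{1/n} = ∞`, with log-convex regularization `M^c`, the following are
equivalent: (1) `∑ 1/β_n = ∞` where `β_n = inf_{k ≥ n} M_k^{1/k}`;
(2) `∑ 1/(M^c_n)^{1/n} = ∞`; (3) `∑ M^c_{n-1}/M^c_n = ∞`. -/
theorem mandelbrojt
    (M : ℕ → ℝ) (hMpos : ∀ n, 0 < M n) (hM0 : M 0 = 1)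
    (hliminf : Filter.Tendsto (fun n : ℕ => M n ^ (((n : ℕ) : ℝ)⁻¹))
        Filter.atTop Filter.atTop)
    (β : ℕ → ℝ) (hβ : ∀ n, β n = ⨅ k : {k : ℕ // n ≤ k}, M k ^ (((k : ℕ) : ℝ)⁻¹))
    (Mc : ℕ → ℝ)
    (hMc : ∀ n, Mc n = sInf {y : ℝ | ∃ k l : ℕ, l ≤ n ∧ 1 ≤ k + l ∧
        y = M (n - l) ^ ((k : ℝ) / ((k : ℝ) + (l : ℝ)))
            * M (n + k) ^ ((l : ℝ) / ((k : ℝ) + (l : ℝ)))}) :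
    ((¬ Summable (fun n : ℕ => 1 / β (n + 1)))
        ↔ ¬ Summable (fun n : ℕ => 1 / (Mc (n + 1)) ^ ((((n : ℕ) : ℝ) + 1)⁻¹)))
    ∧ ((¬ Summable (fun n : ℕ => 1 / (Mc (n + 1)) ^ ((((n : ℕ) : ℝ) + 1)⁻¹)))
        ↔ ¬ Summable (fun n : ℕ => Mc n / Mc (n + 1))) := by
  set a : ℕ → ℝ := fun n => Real.log (M n) with hadef
  have hMa : ∀ n, M n = Real.exp (a n) := fun n => (Real.exp_log (hMpos n)).symm
  have ha0 : a 0 = 0 := by simp [hadef, hM0]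
  have hpow : ∀ n (x : ℝ), M n ^ x = Real.exp (a n * x) := fun n x => by
    rw [hMa, ← Real.exp_mul]
  have ha : Tendsto (fun n : ℕ => a n / (n:ℝ)) atTop atTop := by
    refine (Real.tendsto_log_atTop.comp hliminf).congr (fun n => ?_)
    simp only [Function.comp, hpow, Real.log_exp, div_eq_mul_inv]
  have hlow : ∀ (b s : ℝ), (∀ m : ℕ, b + s * (m:ℝ) ≤ a m) → ∀ n : ℕ,
      ∀ y ∈ {y : ℝ | ∃ k l : ℕ, l ≤ n ∧ 1 ≤ k + l ∧
        y = M (n - l) ^ ((k : ℝ) / ((k : ℝ) + (l : ℝ)))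
            * M (n + k) ^ ((l : ℝ) / ((k : ℝ) + (l : ℝ)))}, Real.exp (b + s * (n:ℝ)) ≤ y := by
    rintro b s hb n y ⟨k, l, hl, hkl, rfl⟩
    rw [hpow, hpow, ← Real.exp_add]
    apply Real.exp_le_exp.2
    have h1 := hb (n - l)
    have h2 := hb (n + k)
    rw [Nat.cast_sub hl] at h1
    push_cast at h2
    have hp : (0:ℝ) < (k:ℝ) + l := by exact_mod_cast hkl
    have hk0 : (0:ℝ) ≤ k := Nat.cast_nonneg k
    have hl0 : (0:ℝ) ≤ l := Nat.cast_nonneg l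
    rw [mul_div_assoc', mul_div_assoc', ← add_div, le_div_iff₀ hp]
    nlinarith [mul_le_mul_of_nonneg_right h1 hk0, mul_le_mul_of_nonneg_right h2 hl0]
  have hlow' : ∀ (b s : ℝ), (∀ m : ℕ, b + s * (m:ℝ) ≤ a m) → ∀ n : ℕ,
      Real.exp (b + s * (n:ℝ)) ≤ Mc n := by
    intro b s hb n
    rw [hMc]
    exact le_csInf ⟨_, 1, 0, Nat.zero_le _, by norm_num, rfl⟩ (hlow b s hb n)
  have hline : ∀ n : ℕ, ∃ (b s : ℝ), (∀ m : ℕ, b + s * (m:ℝ) ≤ a m) ∧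
      Mc n = Real.exp (b + s * (n:ℝ)) ∧ Mc (n+1) = Real.exp (b + s * ((n:ℝ)+1)) ∧
      ∃ q : ℕ, n + 1 ≤ q ∧ a q = b + s * (q:ℝ) := by
    intro n
    obtain ⟨p, q, s, hp, hq, h1, h2⟩ := exists_line a ha n
    have hb : ∀ m : ℕ, (a p - s * p) + s * (m:ℝ) ≤ a m := fun m => by
      have := h2 m
      linarith
    have hval : ∀ n' : ℕ, p ≤ n' → n' ≤ q → Mc n' = Real.exp ((a p - s * p) + s * (n':ℝ)) := by
      intro n' hpn hnq
      apply le_antisymm _ (hlow' _ s hb n')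
      rw [hMc]
      apply csInf_le ⟨_, hlow _ s hb n'⟩
      refine ⟨q - n', n' - p, Nat.sub_le _ _, by omega, ?_⟩
      have e1 : n' - (n' - p) = p := by omega
      have e2 : n' + (q - n') = q := by omega
      rw [e1, e2, hpow, hpow, ← Real.exp_add, Nat.cast_sub hnq, Nat.cast_sub hpn, h1]
      have hne : (q:ℝ) - n' + (n' - p) ≠ 0 := by
        have : (p:ℝ) < q := by exact_mod_cast (lt_of_le_of_lt hp hq)
        have : (0:ℝ) < (q:ℝ) - n' + (n' - p) := by linarith
        exact this.ne'
      congr 1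
      field_simp
      ring
    refine ⟨a p - s * p, s, hb, hval n hp hq.le, ?_, q, hq, by rw [h1]; ring⟩
    have := hval (n+1) (by omega) hq
    push_cast at this
    exact this
  choose b s hb hMn hMn1 q hq hqa using hline
  set c : ℕ → ℝ := fun n => Real.log (Mc n) with hcdef
  have hcn : ∀ n, c n = b n + s n * n := fun n => by simp [hcdef, hMn n]
  have hcn1 : ∀ n, c (n+1) = b n + s n * ((n:ℝ)+1) := fun n => by simp [hcdef, hMn1 n]
  have hMcc : ∀ n, Mc n = Real.exp (c n) := fun n => by rw [hcn, ← hMn]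
  have hcl : ∀ n m : ℕ, b n + s n * m ≤ c m := fun n m => by
    have := hlow' _ _ (hb n) m
    rwa [hMcc, Real.exp_le_exp] at this
  have hc0 : c 0 = 0 := by
    have h : Mc 0 ≤ 1 := by
      rw [hMc]
      apply csInf_le ⟨_, hlow _ _ (hb 0) 0⟩
      exact ⟨1, 0, le_rfl, by norm_num, by simp [hM0]⟩
    have h' : (0:ℝ) ≤ c 0 := by
      obtain ⟨p, q', t, hp, -, -, h2⟩ := exists_line a ha 0
      obtain rfl : p = 0 := by omega
      have := hlow' 0 t (fun m => by have := h2 m; simp [ha0] at this; simpa using this) 0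
      rw [hMcc] at this
      simpa using this
    rw [hMcc] at h
    exact le_antisymm (by simpa using h) h'
  have hs : ∀ n, c (n+1) = c n + s n := fun n => by rw [hcn1, hcn]; ring
  have hmono : Monotone s := by
    apply monotone_nat_of_le_succ
    intro n
    have h1 := hcl n (n+1+1)
    have h2 := hs (n+1)
    have h3 := hcn1 n
    push_cast at h1
    linarith
  have hb0 : ∀ n, b n ≤ 0 := fun n => by simpa [ha0] using hb n 0
  have hbdd : ∀ n : ℕ, BddBelow (Set.range fun k : {k : ℕ // n ≤ k} => M k ^ (((k : ℕ) : ℝ)⁻¹)) :=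
    fun n => ⟨0, by rintro _ ⟨k, rfl⟩; exact (Real.rpow_pos_of_pos (hMpos _) _).le⟩
  have hβup : ∀ n, β (n+1) ≤ Real.exp (s n) := by
    intro n
    rw [hβ]
    refine (ciInf_le (hbdd (n+1)) ⟨q n, hq n⟩).trans ?_
    rw [hpow]
    apply Real.exp_le_exp.2
    have hq0 : (0:ℝ) < q n := by
      have := hq n
      exact_mod_cast (by omega : 0 < q n)
    rw [← div_eq_mul_inv, div_le_iff₀ hq0]
    simp only [hqa]
    linarith [hb0 n]
  have hβlow : ∀ n, Real.exp (c (n+1) / ((n:ℝ)+1)) ≤ β (n+1) := by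
    intro n
    rw [hβ]
    haveI : Nonempty {k : ℕ // n + 1 ≤ k} := ⟨⟨n+1, le_rfl⟩⟩
    apply le_ciInf
    rintro ⟨k, hk⟩
    rw [hpow]
    apply Real.exp_le_exp.2
    have hk' : (n:ℝ) + 1 ≤ k := by exact_mod_cast hk
    have hn : (0:ℝ) < (n:ℝ) + 1 := by positivity
    show _ ≤ a k * (k:ℝ)⁻¹
    rw [← div_eq_mul_inv, div_le_div_iff₀ hn (by linarith), hcn1]
    have h1 := hb n k
    have h2 := hb0 n
    nlinarith
  have hβpos : ∀ n, 0 < β (n+1) := fun n => (Real.exp_pos _).trans_le (hβlow n)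
  have e2 : (fun n : ℕ => 1 / (Mc (n + 1)) ^ ((((n : ℕ) : ℝ) + 1)⁻¹))
      = fun n : ℕ => Real.exp (-(c (n+1) / ((n:ℝ)+1))) := by
    funext n
    rw [hMcc, ← Real.exp_mul, Real.exp_neg, one_div, div_eq_mul_inv]
  have e3 : (fun n : ℕ => Mc n / Mc (n + 1)) = fun n => Real.exp (-s n) := by
    funext n
    rw [hMcc, hMcc, ← Real.exp_sub, hs]
    congr 1; ring
  rw [e2, e3]
  have i32 := carleman_aux c s hc0 hs hmono
  have i21 : Summable (fun n : ℕ => Real.exp (-(c (n+1) / ((n:ℝ)+1)))) →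
      Summable (fun n : ℕ => 1 / β (n + 1)) := by
    intro h
    refine h.of_nonneg_of_le (fun n => (one_div_pos.2 (hβpos n)).le) (fun n => ?_)
    rw [Real.exp_neg, ← one_div]
    exact one_div_le_one_div_of_le (Real.exp_pos _) (hβlow n)
  have i13 : Summable (fun n : ℕ => 1 / β (n + 1)) → Summable (fun n => Real.exp (-s n)) := by
    intro h
    refine h.of_nonneg_of_le (fun n => (Real.exp_pos _).le) (fun n => ?_)
    rw [Real.exp_neg, ← one_div]
    exact one_div_le_one_div_of_le (hβpos n) (hβup n)
  exact ⟨not_congr ⟨fun h => i32 (i13 h), i21⟩, not_congr ⟨fun h => i13 (i21 h), i32⟩⟩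
end

section
/- Let M = (M_n)_{n∈ℕ} be a log-convex sequence of positive real numbers with M_0 = 1, and let f be a C^∞ function on [a,b] ⊂ ℝ (a < b) with sup_{t∈[a,b]} |f^{(n)}(t)| ≤ M_n for all n ∈ ℕ. For n ∈ ℕ and t ∈ [a,b] set B_{f,n}(t) = sup_{j≥n} |f^{(j)}(t)|/(e^j M_j). Then for every q ∈ ℕ with q > n and all t, t+τ ∈ [a,b]: B_{f,n}(t+τ) ≤ max(B_{f,n}(t), e^{-q}) · exp(e·|τ|·M_q/M_{q-1}). -/
open Set

/-- Bang's estimate: for a log-convex sequence `M` with `M 0 = 1`, a `C^∞` function `f`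
on `[a,b]` with `|f^(n)| ≤ M n`, and `B_{f,n}(t) = sup_{j ≥ n} |f^(j)(t)|/(e^j M_j)`,
one has `B_{f,n}(t+τ) ≤ max (B_{f,n}(t)) (e^{-q}) · exp(e·|τ|·M_q/M_{q-1})` for `q > n`. -/
theorem bang_lemma_estimate
    (a b : ℝ) (hab : a < b)
    (M : ℕ → ℝ) (hMpos : ∀ n, 0 < M n) (hM0 : M 0 = 1)
    (hconv : ∀ n : ℕ, (M (n + 1)) ^ 2 ≤ M n * M (n + 2))
    (f : ℝ → ℝ) (hf : ContDiffOn ℝ (⊤ : ℕ∞) f (Set.Icc a b))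
    (hbound : ∀ n : ℕ, ∀ t ∈ Set.Icc a b,
        |iteratedDerivWithin n f (Set.Icc a b) t| ≤ M n)
    (B : ℕ → ℝ → ℝ)
    (hB : ∀ n t, B n t = ⨆ j : {j : ℕ // n ≤ j},
        |iteratedDerivWithin (j : ℕ) f (Set.Icc a b) t|
          / (Real.exp ((j : ℕ) : ℝ) * M j))
    (n q : ℕ) (hq : n < q)
    (t τ : ℝ) (ht : t ∈ Set.Icc a b) (htτ : t + τ ∈ Set.Icc a b) :
    B n (t + τ) ≤ max (B n t) (Real.exp (-(q : ℝ)))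
        * Real.exp (Real.exp 1 * |τ| * (M q / M (q - 1))) := by
  set S := Set.Icc a b with hS
  have hU : UniqueDiffOn ℝ S := uniqueDiffOn_Icc hab
  have hE : ∀ j : ℕ, 0 < Real.exp (j : ℝ) * M j := fun j => mul_pos (Real.exp_pos _) (hMpos j)
  set r := M q / M (q - 1) with hr
  have hr0 : 0 < r := div_pos (hMpos _) (hMpos _)
  set C := max (B n t) (Real.exp (-(q : ℝ))) with hC
  have hC0 : 0 < C := lt_of_lt_of_le (Real.exp_pos _) (le_max_right _ _)
  have hCq : Real.exp (-(q : ℝ)) ≤ C := le_max_right _ _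
  -- ratios are monotone
  have hmono : Monotone (fun k => M (k + 1) / M k) := by
    apply monotone_nat_of_le_succ
    intro k
    rw [div_le_div_iff₀ (hMpos _) (hMpos _)]
    nlinarith [hconv k]
  have hratio : ∀ j, j < q → M (j + 1) ≤ r * M j := by
    intro j hj
    have h := hmono (show j ≤ q - 1 by omega)
    simp only [show q - 1 + 1 = q by omega] at h
    rwa [div_le_iff₀ (hMpos j)] at h
  -- terms at the point `t`
  have hterm : ∀ (j : ℕ) (s : ℝ), s ∈ S →
      |iteratedDerivWithin j f S s| / (Real.exp (j : ℝ) * M j) ≤ Real.exp (-(j : ℝ)) := by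
    intro j s hs
    rw [div_le_iff₀ (hE j), ← mul_assoc, ← Real.exp_add]
    simpa using hbound j s hs
  have hbase : ∀ j, n ≤ j → |iteratedDerivWithin j f S t| ≤ C * (Real.exp (j : ℝ) * M j) := by
    intro j hj
    rw [← div_le_iff₀ (hE j)]
    refine le_trans ?_ (le_max_left _ _)
    rw [hB n t]
    refine le_ciSup (f := fun j : {j : ℕ // n ≤ j} =>
      |iteratedDerivWithin (j : ℕ) f S t| / (Real.exp ((j : ℕ) : ℝ) * M j)) ?_ ⟨j, hj⟩
    refine ⟨1, ?_⟩
    rintro _ ⟨i, rfl⟩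
    refine (hterm i t ht).trans ?_
    rw [Real.exp_le_one_iff]
    simp
  set c := Real.exp 1 * |τ| * r with hc
  have hc0 : 0 ≤ c := by positivity
  have hpath : ∀ u ∈ Set.Icc (0 : ℝ) 1, t + u * τ ∈ S := by
    intro u hu
    have h := (convex_Icc a b) ht htτ (sub_nonneg.2 hu.2) hu.1 (by ring)
    simp only [smul_eq_mul] at h
    convert h using 1
    ring
  -- downward induction
  have key : ∀ k j, j + k = q → n ≤ j → ∀ u ∈ Set.Icc (0 : ℝ) 1,
      ‖iteratedDerivWithin j f S (t + u * τ)‖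
        ≤ C * (Real.exp (j : ℝ) * M j) * Real.exp (c * u) := by
    intro k
    induction k with
    | zero =>
      intro j hj hn u hu
      obtain rfl : j = q := by omega
      have h1 := (div_le_iff₀ (hE j)).1 ((hterm j _ (hpath u hu)).trans hCq)
      rw [Real.norm_eq_abs]
      refine h1.trans (le_mul_of_one_le_right (mul_pos hC0 (hE j)).le ?_)
      exact Real.one_le_exp (mul_nonneg hc0 hu.1)
    | succ k ih =>
      intro j hj hn
      have ih' := ih (j + 1) (by omega) (by omega)
      have hder : ∀ u ∈ Set.Icc (0 : ℝ) 1,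
          HasDerivWithinAt (fun u => iteratedDerivWithin j f S (t + u * τ))
            (iteratedDerivWithin (j + 1) f S (t + u * τ) * τ) (Set.Icc 0 1) u := by
        intro u hu
        have hd : DifferentiableWithinAt ℝ (iteratedDerivWithin j f S) S (t + u * τ) :=
          (hf.differentiableOn_iteratedDerivWithin (by exact_mod_cast WithTop.coe_lt_top j) hU)
            _ (hpath u hu)
        have h1 := hd.hasDerivWithinAt
        rw [← iteratedDerivWithin_succ] at h1
        have h2 : HasDerivWithinAt (fun u : ℝ => t + u * τ) τ (Set.Icc 0 1) u := by
          simpa using (((hasDerivAt_id u).mul_const τ).const_add t).hasDerivWithinAt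
        exact HasDerivWithinAt.comp u h1 h2 hpath
      set K := C * (Real.exp (j : ℝ) * M j) with hK
      have hBd : ∀ u : ℝ, HasDerivAt (fun u => K * Real.exp (c * u))
          (K * (Real.exp (c * u) * c)) u := by
        intro u
        have h := ((hasDerivAt_id u).const_mul c).exp.const_mul K
        simpa using h
      refine image_norm_le_of_norm_deriv_right_le_deriv_boundary
        (f' := fun u => iteratedDerivWithin (j + 1) f S (t + u * τ) * τ)
        (B' := fun u => K * (Real.exp (c * u) * c))
        (fun u hu => (hder u hu).continuousWithinAt) ?_ ?_ hBd ?_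
      · intro u hu
        exact (hder u ⟨hu.1, hu.2.le⟩).mono_of_mem_nhdsWithin
          (Icc_mem_nhdsGE_of_mem hu)
      · simpa using hbase j hn
      · intro u hu
        have h := ih' u ⟨hu.1, hu.2.le⟩
        have hrj := hratio j (by omega)
        rw [norm_mul, Real.norm_eq_abs τ]
        calc _ ≤ C * (Real.exp ((j + 1 : ℕ) : ℝ) * M (j + 1)) * Real.exp (c * u) * |τ| := by
              gcongr
          _ ≤ C * (Real.exp ((j + 1 : ℕ) : ℝ) * (r * M j)) * Real.exp (c * u) * |τ| := by
              gcongr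
          _ = _ := by
              rw [hK, hc]
              push_cast
              rw [Real.exp_add]
              ring
  rw [hB n (t + τ)]
  haveI : Nonempty {j : ℕ // n ≤ j} := ⟨⟨n, le_rfl⟩⟩
  refine ciSup_le ?_
  rintro ⟨j, hj⟩
  rcases le_total j q with hjq | hjq
  · have h := key (q - j) j (by omega) hj 1 (by simp)
    simp only [one_mul, mul_one, Real.norm_eq_abs] at h
    rw [div_le_iff₀ (hE j)]
    linarith
  · refine (hterm j _ htτ).trans ?_
    have h1 : Real.exp (-(j : ℝ)) ≤ Real.exp (-(q : ℝ)) := by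
      apply Real.exp_le_exp.2
      have : (q : ℝ) ≤ j := by exact_mod_cast hjq
      linarith
    exact (h1.trans hCq).trans (le_mul_of_one_le_right hC0.le (Real.one_le_exp hc0))
end

section
/- (Bang.) Let M = (M_n)_{n∈ℕ} be a log-convex sequence of positive real numbers with M_0 = 1 satisfying ∑_{n=1}^∞ M_{n-1}/M_n = ∞. Let f be a C^∞ function on [a,b] ⊂ ℝ (a < b) with sup_{t∈[a,b]} |f^{(n)}(t)| ≤ M_n for all n ∈ ℕ, and suppose there exists a sequence (x_n)_{n∈ℕ} with x_n ∈ [a,b] and f^{(n)}(x_n) = 0 for all n ∈ ℕ. If f is not identically zero on [a,b], then the series ∑_{n=1}^∞ |x_{n-1} − x_n| diverges. -/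
open Set

/-- Comparison lemma on an interval, both sides. -/
lemma bang_growth (a b : ℝ) (g g' : ℝ → ℝ)
    (hg : ∀ t ∈ Icc a b, HasDerivWithinAt g (g' t) (Icc a b) t)
    (K k x y : ℝ) (hx : x ∈ Icc a b) (hy : y ∈ Icc a b)
    (hb : ∀ t ∈ Icc a b, |g' t| ≤ K * (k * Real.exp (k * |t - x|)))
    (h0 : |g x| ≤ K) : |g y| ≤ K * Real.exp (k * |y - x|) := by
  obtain ⟨σ, hσ, hσy⟩ : ∃ σ : ℝ, |σ| = 1 ∧ y = x + σ * |y - x| := by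
    rcases le_total 0 (y - x) with h | h
    · exact ⟨1, by simp, by rw [abs_of_nonneg h]; ring⟩
    · exact ⟨-1, by simp, by rw [abs_of_nonpos h]; ring⟩
  set L := |y - x| with hL
  have hL0 : 0 ≤ L := abs_nonneg _
  have hmem : ∀ s ∈ Icc 0 L, x + σ * s ∈ Icc a b := by
    intro s hs
    have := hs.1
    have := hs.2
    have := hx.1
    have := hx.2
    have := hy.1
    have := hy.2
    rcases (abs_eq (by norm_num : (0:ℝ) ≤ 1)).1 hσ with h | h <;> subst h <;>
      constructor <;> linarith
  have hder : ∀ s ∈ Icc 0 L, HasDerivWithinAt (fun s => g (x + σ * s)) (g' (x + σ * s) * σ)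
      (Icc 0 L) s := by
    intro s hs
    have h1 : HasDerivWithinAt (fun s : ℝ => x + σ * s) σ (Icc 0 L) s := by
      simpa using ((hasDerivWithinAt_id s (Icc 0 L)).const_mul σ).const_add x
    exact (hg _ (hmem s hs)).comp s h1 hmem
  have key := image_norm_le_of_norm_deriv_right_le_deriv_boundary
    (f := fun s => g (x + σ * s)) (f' := fun s => g' (x + σ * s) * σ) (a := 0) (b := L)
    (B := fun s => K * Real.exp (k * s)) (B' := fun s => K * (k * Real.exp (k * s)))
    (fun s hs => (hder s hs).continuousWithinAt)
    (fun s hs => ((hder s ⟨hs.1, hs.2.le⟩).mono_of_mem_nhdsWithin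
      (Icc_mem_nhdsGE_of_mem hs)))
    (by simpa using h0)
    (by
      intro s
      have h1 : HasDerivAt (fun s : ℝ => k * s) k s := by
        simpa using (hasDerivAt_id s).const_mul k
      have := (h1.exp).const_mul K
      exact this.congr_deriv (by ring))
    (by
      intro s hs
      have h1 := hb _ (hmem s ⟨hs.1, hs.2.le⟩)
      have h2 : |x + σ * s - x| = s := by
        rw [add_sub_cancel_left, abs_mul, hσ, one_mul, abs_of_nonneg hs.1]
      rw [h2] at h1
      rw [Real.norm_eq_abs, abs_mul, hσ, mul_one]
      exact h1)
    (right_mem_Icc.2 hL0)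
  simp only [Real.norm_eq_abs] at key
  rwa [← hσy] at key

/-- Truncated piecewise linear function. -/
noncomputable def bangL (l : ℕ → ℝ) (P : ℕ) (s : ℝ) : ℝ :=
  ∑ i ∈ Finset.range P, l i * (min s ((i : ℝ) + 1) - min s (i : ℝ))

lemma bangL_full (l : ℕ → ℝ) (P : ℕ) (s : ℝ) (hs : (P : ℝ) ≤ s) :
    bangL l P s = ∑ i ∈ Finset.range P, l i := by
  apply Finset.sum_congr rfl
  intro i hi
  have : (i : ℝ) + 1 ≤ P := by exact_mod_cast Finset.mem_range.1 hi
  rw [min_eq_right (by linarith), min_eq_right (by linarith)]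
  ring

lemma bangL_le (l : ℕ → ℝ) (hl : ∀ i, 0 < l i) (P N : ℕ) (s : ℝ) (hs : s ≤ N) :
    bangL l P s ≤ ∑ i ∈ Finset.range N, l i := by
  calc bangL l P s ≤ ∑ i ∈ Finset.range P, if i < N then l i else 0 := by
        apply Finset.sum_le_sum
        intro i _
        split_ifs with h
        · have : min s ((i : ℝ) + 1) - min s (i : ℝ) ≤ 1 := by
            rcases min_cases s ((i : ℝ) + 1) with h | h <;>
              rcases min_cases s (i : ℝ) with h' | h' <;> linarith
          nlinarith [hl i]
        · have : (N : ℝ) ≤ i := by exact_mod_cast not_lt.1 h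
          rw [min_eq_left (by linarith), min_eq_left (by linarith)]
          simp
    _ = ∑ i ∈ (Finset.range P).filter (· < N), l i := by rw [Finset.sum_filter]
    _ ≤ _ := by
        apply Finset.sum_le_sum_of_subset_of_nonneg
        · intro i hi
          simp at hi ⊢
          exact hi.2
        · intro i _ _
          exact (hl i).le

lemma bangL_lip (l : ℕ → ℝ) (hl : ∀ i, 0 < l i) (a b : ℝ) (τ : ℝ → ℝ) (P : ℕ)
    (h : ∀ i < P, ∀ x ∈ Icc a b, ∀ y ∈ Icc a b,
      l i * (min (τ y) ((i : ℝ) + 1) - min (τ x) ((i : ℝ) + 1)) ≤ |x - y|) :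
    ∀ x ∈ Icc a b, ∀ y ∈ Icc a b, bangL l P (τ y) - bangL l P (τ x) ≤ |x - y| := by
  induction P with
  | zero => intro x _ y _; simp [bangL]
  | succ P ih =>
    have ih := ih (fun i hi => h i (by omega))
    intro x hx y hy
    have hs : ∀ s, bangL l (P + 1) s
        = bangL l P s + l P * (min s ((P : ℝ) + 1) - min s (P : ℝ)) := fun s => by
      rw [bangL, Finset.sum_range_succ]; rfl
    have hP := h P (by omega)
    have hlP := hl P
    rw [hs, hs]
    rcases le_or_gt (τ y) P with h1 | h1
    · have e : min (τ y) ((P : ℝ) + 1) - min (τ y) (P : ℝ) = 0 := by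
        rw [min_eq_left (by linarith), min_eq_left h1]; ring
      have e2 : 0 ≤ min (τ x) ((P : ℝ) + 1) - min (τ x) (P : ℝ) := by
        have : min (τ x) (P : ℝ) ≤ min (τ x) ((P : ℝ) + 1) :=
          min_le_min le_rfl (by linarith)
        linarith
      rw [e]
      have := ih x hx y hy
      have := mul_nonneg hlP.le e2
      linarith
    · rcases le_or_gt (P : ℝ) (τ x) with h2 | h2
      · rw [bangL_full l P _ h2, bangL_full l P _ h1.le, min_eq_right h1.le, min_eq_right h2]
        have := hP x hx y hy
        linarith
      · -- intermediate value
        have hsub : uIcc x y ⊆ Icc a b := by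
          rw [← uIcc_of_le (hx.1.trans hx.2)]
          exact uIcc_subset_uIcc (by rwa [uIcc_of_le (hx.1.trans hx.2)])
            (by rwa [uIcc_of_le (hx.1.trans hx.2)])
        have hcont : ContinuousOn (fun z => min (τ z) ((P : ℝ) + 1)) (uIcc x y) := by
          have : LipschitzOnWith (Real.toNNReal (1 / l P))
              (fun z => min (τ z) ((P : ℝ) + 1)) (uIcc x y) := by
            apply LipschitzOnWith.of_dist_le_mul
            intro u hu v hv
            have p := hP u (hsub hu) v (hsub hv)
            have q := hP v (hsub hv) u (hsub hu)
            rw [abs_sub_comm] at q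
            rw [Real.coe_toNNReal _ (by positivity), Real.dist_eq, Real.dist_eq, div_mul_eq_mul_div,
              one_mul, le_div_iff₀ hlP]
            rcases abs_cases (min (τ u) ((P : ℝ) + 1) - min (τ v) ((P : ℝ) + 1)) with h | h <;>
              rw [h.1] <;> linarith
          exact this.continuousOn
        obtain ⟨z, hz, hzP⟩ := intermediate_value_uIcc hcont (show (P : ℝ) ∈ _ by
          rw [mem_uIcc]
          left
          exact ⟨(min_le_left _ _).trans h2.le, le_min h1.le (by linarith)⟩)
        have hzτ : τ z = P := by
          simp only at hzP
          rcases min_cases (τ z) ((P : ℝ) + 1) with h | h <;> linarith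
        have i1 := ih x hx z (hsub hz)
        have i2 := hP z (hsub hz) y hy
        rw [bangL_full l P _ hzτ.ge] at i1
        rw [bangL_full l P _ h1.le, min_eq_right h1.le, min_eq_left (show τ x ≤ (P : ℝ) + 1 by linarith),
          min_eq_left h2.le]
        rw [hzτ, min_eq_left (show (P : ℝ) ≤ P + 1 by linarith)] at i2
        have : |x - z| + |z - y| = |x - y| := by
          rcases mem_uIcc.1 hz with h | h
          · rw [abs_of_nonpos (by linarith), abs_of_nonpos (by linarith),
              abs_of_nonpos (by linarith)]; ring
          · rw [abs_of_nonneg (by linarith), abs_of_nonneg (by linarith),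
              abs_of_nonneg (by linarith)]; ring
        linarith

/-- Bang degree of order `n`. -/
noncomputable def bangB (M : ℕ → ℝ) (F : ℕ → ℝ → ℝ) (n : ℕ) (z : ℝ) : ℝ :=
  ⨆ j : ℕ, if n ≤ j then |F j z| / (Real.exp j * M j) else 0

lemma bangB_le_exp (a b : ℝ) (M : ℕ → ℝ) (hMpos : ∀ n, 0 < M n) (F : ℕ → ℝ → ℝ)
    (hbound : ∀ n : ℕ, ∀ t ∈ Set.Icc a b, |F n t| ≤ M n)
    (n : ℕ) (z : ℝ) (hz : z ∈ Icc a b) :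
    ∀ j : ℕ, (if n ≤ j then |F j z| / (Real.exp j * M j) else 0) ≤ Real.exp (-(n : ℝ)) := by
  intro j
  split_ifs with h
  · rw [div_le_iff₀ (mul_pos (Real.exp_pos _) (hMpos j)), ← mul_assoc, ← Real.exp_add]
    have : (n : ℝ) ≤ j := by exact_mod_cast h
    have h1 : 1 ≤ Real.exp (-(n : ℝ) + j) := Real.one_le_exp (by linarith)
    nlinarith [hbound j z hz, hMpos j]
  · positivity

lemma bangB_ge (a b : ℝ) (M : ℕ → ℝ) (hMpos : ∀ n, 0 < M n) (F : ℕ → ℝ → ℝ)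
    (hbound : ∀ n : ℕ, ∀ t ∈ Set.Icc a b, |F n t| ≤ M n)
    (n j : ℕ) (hj : n ≤ j) (z : ℝ) (hz : z ∈ Icc a b) :
    |F j z| ≤ bangB M F n z * (Real.exp j * M j) := by
  rw [← div_le_iff₀ (mul_pos (Real.exp_pos _) (hMpos j))]
  have := le_ciSup (f := fun j : ℕ => if n ≤ j then |F j z| / (Real.exp j * M j) else 0)
    ⟨_, by rintro _ ⟨j, rfl⟩; exact bangB_le_exp a b M hMpos F hbound n z hz j⟩ j
  simpa [hj, bangB] using this

lemma bangB_step (a b : ℝ) (M : ℕ → ℝ) (hMpos : ∀ n, 0 < M n) (F : ℕ → ℝ → ℝ)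
    (hbound : ∀ n : ℕ, ∀ t ∈ Set.Icc a b, |F n t| ≤ M n)
    (hconv : ∀ n : ℕ, (M (n + 1)) ^ 2 ≤ M n * M (n + 2))
    (hder : ∀ n, ∀ t ∈ Icc a b, HasDerivWithinAt (F n) (F (n + 1) t) (Icc a b) t)
    (n N : ℕ) (x y : ℝ) (hx : x ∈ Icc a b) (hy : y ∈ Icc a b) :
    max (bangB M F n y) (Real.exp (-((N : ℝ) + 1))) ≤
      max (bangB M F n x) (Real.exp (-((N : ℝ) + 1))) *
        Real.exp (Real.exp 1 * (M (N + 1) / M N) * |y - x|) := by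
  set C := max (bangB M F n x) (Real.exp (-((N : ℝ) + 1))) with hC
  set k := Real.exp 1 * (M (N + 1) / M N) with hk
  have hk0 : 0 < k := mul_pos (Real.exp_pos _) (div_pos (hMpos _) (hMpos _))
  have hC0 : 0 < C := lt_max_of_lt_right (Real.exp_pos _)
  have hmono : Monotone (fun i => M (i + 1) / M i) := by
    apply monotone_nat_of_le_succ
    intro i
    rw [div_le_div_iff₀ (hMpos _) (hMpos _)]
    nlinarith [hconv i]
  have hexp1 : ∀ z, 1 ≤ Real.exp (k * |z - x|) := fun z => Real.one_le_exp (by positivity)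
  have hbig : ∀ j, N + 1 ≤ j → ∀ z ∈ Icc a b,
      |F j z| ≤ C * (Real.exp j * M j) * Real.exp (k * |z - x|) := by
    intro j hj z hz
    have hj' : (N : ℝ) + 1 ≤ j := by exact_mod_cast hj
    have h1 : 1 ≤ C * Real.exp j := by
      calc 1 ≤ Real.exp (-((N : ℝ) + 1)) * Real.exp j := by
            rw [← Real.exp_add]; exact Real.one_le_exp (by linarith)
        _ ≤ _ := by gcongr; exact le_max_right _ _
    calc |F j z| ≤ M j := hbound j z hz
      _ ≤ (C * Real.exp j) * M j := le_mul_of_one_le_left (hMpos j).le h1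
      _ = C * (Real.exp j * M j) := by ring
      _ ≤ _ := le_mul_of_one_le_right (by have := hMpos j; positivity) (hexp1 z)
  have hall : ∀ d j, N + 1 ≤ j + d → n ≤ j → ∀ z ∈ Icc a b,
      |F j z| ≤ C * (Real.exp j * M j) * Real.exp (k * |z - x|) := by
    intro d
    induction d with
    | zero => intro j hj _; exact hbig j hj
    | succ d ih =>
      intro j hj hnj
      by_cases hjN : N + 1 ≤ j
      · exact hbig j hjN
      intro z hz
      apply bang_growth a b (F j) (F (j + 1)) (hder j) _ k x z hx hz
      · intro t ht
        refine (ih (j + 1) (by omega) (by omega) t ht).trans ?_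
        have h1 : M (j + 1) / M j ≤ M (N + 1) / M N := hmono (by omega : j ≤ N)
        rw [div_le_iff₀ (hMpos j)] at h1
        rw [← mul_assoc (C * (Real.exp j * M j)) k]
        apply mul_le_mul_of_nonneg_right _ (Real.exp_pos _).le
        have e : Real.exp ((j + 1 : ℕ) : ℝ) = Real.exp j * Real.exp 1 := by
          rw [← Real.exp_add]; push_cast; rfl
        rw [e]
        calc C * (Real.exp j * Real.exp 1 * M (j + 1))
            = C * Real.exp j * Real.exp 1 * M (j + 1) := by ring
          _ ≤ C * Real.exp j * Real.exp 1 * (M (N + 1) / M N * M j) := by gcongr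
          _ = _ := by rw [hk]; ring
      · refine (bangB_ge a b M hMpos F hbound n j hnj x hx).trans ?_
        have := hMpos j
        gcongr
        exact le_max_left _ _
  apply max_le
  · apply ciSup_le
    intro j
    split_ifs with h
    · rw [div_le_iff₀ (mul_pos (Real.exp_pos _) (hMpos j))]
      have := hall (N + 1) j (by omega) h y hy
      linarith
    · positivity
  · exact (le_max_right _ _).trans (le_mul_of_one_le_right hC0.le (hexp1 y))

/-- Bang's theorem: let `M` be log-convex with `M 0 = 1` and `∑ M_{n-1}/M_n = ∞`. If a
`C^∞` function `f` on `[a,b]` satisfies `|f^(n)| ≤ M n` on `[a,b]`, has `f^(n)(x_n) = 0`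
for a sequence `(x_n) ⊂ [a,b]`, and is not identically zero, then
`∑ |x_{n-1} - x_n|` diverges. -/
theorem bang_theorem
    (a b : ℝ) (hab : a < b)
    (M : ℕ → ℝ) (hMpos : ∀ n, 0 < M n) (hM0 : M 0 = 1)
    (hconv : ∀ n : ℕ, (M (n + 1)) ^ 2 ≤ M n * M (n + 2))
    (hdiv : ¬ Summable (fun n : ℕ => M n / M (n + 1)))
    (f : ℝ → ℝ) (hf : ContDiffOn ℝ (⊤ : ℕ∞) f (Set.Icc a b))
    (hbound : ∀ n : ℕ, ∀ t ∈ Set.Icc a b,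
        |iteratedDerivWithin n f (Set.Icc a b) t| ≤ M n)
    (x : ℕ → ℝ) (hx : ∀ n, x n ∈ Set.Icc a b)
    (hzero : ∀ n : ℕ, iteratedDerivWithin n f (Set.Icc a b) (x n) = 0)
    (hne : ∃ t ∈ Set.Icc a b, f t ≠ 0) :
    ¬ Summable (fun n : ℕ => |x n - x (n + 1)|) := by
  intro hsum
  set F : ℕ → ℝ → ℝ := fun n => iteratedDerivWithin n f (Set.Icc a b) with hF
  obtain ⟨t, ht, hft⟩ := hne
  have hder : ∀ n, ∀ t ∈ Icc a b, HasDerivWithinAt (F n) (F (n + 1) t) (Icc a b) t := by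
    intro n t ht
    have hd : DifferentiableOn ℝ (iteratedDerivWithin n f (Icc a b)) (Icc a b) :=
      hf.differentiableOn_iteratedDerivWithin (by exact_mod_cast WithTop.coe_lt_top _)
        (uniqueDiffOn_Icc hab)
    have := (hd t ht).hasDerivWithinAt
    rwa [← iteratedDerivWithin_succ] at this
  set l : ℕ → ℝ := fun i => M i / M (i + 1) / Real.exp 1 with hl
  have hlpos : ∀ i, 0 < l i := fun i =>
    div_pos (div_pos (hMpos _) (hMpos _)) (Real.exp_pos _)
  -- the path
  let y : ℕ → ℝ := fun n => Nat.casesOn n t x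
  have hy : ∀ n, y n ∈ Icc a b := by
    intro n
    cases n with
    | zero => exact ht
    | succ n => exact hx n
  have hysum : Summable (fun n => |y n - y (n + 1)|) := (summable_nat_add_iff 1).1 hsum
  obtain ⟨N0, hN0⟩ : ∃ N0 : ℕ, -Real.log |f t| ≤ N0 := exists_nat_ge _
  apply hdiv
  have hls : Summable l := by
    refine summable_of_sum_range_le
      (c := (∑' n, |y n - y (n + 1)|) + ∑ i ∈ Finset.range N0, l i) (fun i => (hlpos i).le) ?_
    intro P
    let τ : ℕ → ℝ → ℝ := fun n z => -Real.log (max (bangB M F n z) (Real.exp (-(P : ℝ))))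
    have hmin : ∀ n z (i : ℕ), i < P → min (τ n z) ((i : ℝ) + 1)
        = -Real.log (max (bangB M F n z) (Real.exp (-((i : ℝ) + 1)))) := by
      intro n z i hi
      have hi' : (i : ℝ) + 1 ≤ P := by exact_mod_cast hi
      have hpos : 0 < max (bangB M F n z) (Real.exp (-(P : ℝ))) :=
        lt_max_of_lt_right (Real.exp_pos _)
      have hle : Real.exp (-(P : ℝ)) ≤ Real.exp (-((i : ℝ) + 1)) :=
        Real.exp_le_exp.2 (by linarith)
      have e : max (bangB M F n z) (Real.exp (-((i : ℝ) + 1)))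
          = max (max (bangB M F n z) (Real.exp (-(P : ℝ)))) (Real.exp (-((i : ℝ) + 1))) := by
        rw [max_assoc, max_eq_right hle]
      rw [e]
      simp only [τ]
      rcases le_total (max (bangB M F n z) (Real.exp (-(P : ℝ))))
        (Real.exp (-((i : ℝ) + 1))) with h | h
      · rw [max_eq_right h, Real.log_exp, neg_neg, min_eq_right]
        have := Real.log_le_log hpos h
        rw [Real.log_exp] at this
        linarith
      · rw [max_eq_left h, min_eq_left]
        have := Real.log_le_log (Real.exp_pos _) h
        rw [Real.log_exp] at this
        linarith
    have hlip : ∀ n, ∀ u ∈ Icc a b, ∀ v ∈ Icc a b,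
        bangL l P (τ n v) - bangL l P (τ n u) ≤ |u - v| := by
      intro n
      apply bangL_lip l hlpos a b (τ n) P
      intro i hi u hu v hv
      rw [hmin n u i hi, hmin n v i hi]
      have hs := bangB_step a b M hMpos F hbound hconv hder n i v u hv hu
      have h1 : 0 < max (bangB M F n u) (Real.exp (-((i : ℝ) + 1))) :=
        lt_max_of_lt_right (Real.exp_pos _)
      have h2 : 0 < max (bangB M F n v) (Real.exp (-((i : ℝ) + 1))) :=
        lt_max_of_lt_right (Real.exp_pos _)
      have hs := Real.log_le_log h1 hs
      rw [Real.log_mul h2.ne' (Real.exp_pos _).ne', Real.log_exp] at hs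
      have hlk : l i * (Real.exp 1 * (M (i + 1) / M i)) = 1 := by
        simp only [hl]
        have := (hMpos i).ne'
        have := (hMpos (i + 1)).ne'
        have := (Real.exp_pos 1).ne'
        field_simp
      calc _ ≤ l i * (Real.exp 1 * (M (i + 1) / M i) * |u - v|) := by
            apply mul_le_mul_of_nonneg_left _ (hlpos i).le
            linarith
        _ = |u - v| := by rw [← mul_assoc, hlk, one_mul]
    have hswitch : ∀ n, τ (n + 1) (y (n + 1)) = τ n (y (n + 1)) := by
      intro n
      have : bangB M F (n + 1) (y (n + 1)) = bangB M F n (y (n + 1)) := by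
        unfold bangB
        congr 1
        funext j
        by_cases h : n + 1 ≤ j
        · rw [if_pos h, if_pos (by omega)]
        · rw [if_neg h]
          split_ifs with h'
          · obtain rfl : j = n := by omega
            have : F j (y (j + 1)) = 0 := hzero j
            rw [this]; simp
          · rfl
      simp only [τ, this]
    have htel : ∀ n, bangL l P (τ n (y n)) - bangL l P (τ 0 (y 0))
        ≤ ∑ i ∈ Finset.range n, |y i - y (i + 1)| := by
      intro n
      induction n with
      | zero => simp
      | succ n ih =>
        rw [Finset.sum_range_succ, hswitch]
        have := hlip n (y n) (hy n) (y (n + 1)) (hy (n + 1))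
        linarith
    have hend : bangL l P (τ P (y P)) = ∑ i ∈ Finset.range P, l i := by
      apply bangL_full
      have h1 : bangB M F P (y P) ≤ Real.exp (-(P : ℝ)) :=
        ciSup_le (bangB_le_exp a b M hMpos F hbound P (y P) (hy P))
      simp only [τ]
      rw [max_eq_right h1, Real.log_exp, neg_neg]
    have hstart : bangL l P (τ 0 (y 0)) ≤ ∑ i ∈ Finset.range N0, l i := by
      apply bangL_le l hlpos
      refine le_trans ?_ hN0
      simp only [τ]
      apply neg_le_neg
      apply Real.log_le_log (abs_pos.2 hft)
      apply le_max_of_le_left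
      change |f t| ≤ bangB M F 0 t
      have := bangB_ge a b M hMpos F hbound 0 0 le_rfl t ht
      simpa [hF, hM0] using this
    have := htel P
    have := hysum.sum_le_tsum (Finset.range P) (fun i _ => abs_nonneg _)
    linarith
  have := hls.mul_right (Real.exp 1)
  refine this.congr (fun i => ?_)
  simp only [hl]
  rw [div_mul_cancel₀ _ (Real.exp_pos 1).ne']
end

section
/- Let M = (M_n)_{n∈ℕ} be a log-convex sequence of positive real numbers with M_0 = 1 satisfying ∑_{n=1}^∞ M_{n-1}/M_n = ∞. Let f be a C^∞ function on [a,b] ⊂ ℝ (a < b) with sup_{t∈[a,b]} |f^{(n)}(t)| ≤ M_n for all n ∈ ℕ. If f^{(n)}(a) > 0 for all n ∈ ℕ, then f^{(n)}(x) > 0 for all n ∈ ℕ and all x ∈ [a,b]. -/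
open Set

/-- First-order growth estimate along a segment. -/
lemma mp_scalar (a b : ℝ) (G G' : ℝ → ℝ)
    (hG : ∀ t ∈ Icc a b, HasDerivWithinAt G (G' t) (Icc a b) t)
    (x y : ℝ) (hx : x ∈ Icc a b) (hy : y ∈ Icc a b) (C c : ℝ) (hc : 0 < c)
    (hb : ∀ t ∈ Icc a b, |G' t| ≤ C * Real.exp (c * |t - x|)) :
    |G y| ≤ |G x| + C / c * (Real.exp (c * |y - x|) - 1) := by
  have hmem : ∀ s ∈ Icc (0 : ℝ) 1, x + s * (y - x) ∈ Icc a b := by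
    intro s hs
    obtain ⟨h0, h1⟩ := hs
    obtain ⟨hx0, hx1⟩ := hx
    obtain ⟨hy0, hy1⟩ := hy
    constructor <;> nlinarith
  have hder : ∀ s ∈ Icc (0 : ℝ) 1, HasDerivWithinAt (fun s => G (x + s * (y - x)))
      (G' (x + s * (y - x)) * (y - x)) (Icc 0 1) s := by
    intro s hs
    have h1 : HasDerivWithinAt (fun s : ℝ => x + s * (y - x)) (y - x) (Icc 0 1) s := by
      have := (((hasDerivAt_id s).mul_const (y - x)).const_add x).hasDerivWithinAt (s := Icc 0 1)
      simpa using this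
    exact (hG _ (hmem s hs)).comp s h1 (fun s hs => hmem s hs)
  have key := image_norm_le_of_norm_deriv_right_le_deriv_boundary
    (f := fun s => G (x + s * (y - x))) (f' := fun s => G' (x + s * (y - x)) * (y - x))
    (a := 0) (b := 1)
    (B := fun s => |G x| + C / c * (Real.exp (c * |y - x| * s) - 1))
    (B' := fun s => C / c * (Real.exp (c * |y - x| * s) * (c * |y - x|)))
    (fun s hs => (hder s hs).continuousWithinAt)
    (fun s hs => (hder s ⟨hs.1, hs.2.le⟩).mono_of_mem_nhdsWithin
      (Icc_mem_nhdsGE_of_mem hs))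
    (by simp)
    (fun s => by
      have h1 : HasDerivAt (fun s : ℝ => c * |y - x| * s) (c * |y - x|) s := by
        simpa using (hasDerivAt_id s).const_mul (c * |y - x|)
      exact ((h1.exp.sub_const 1).const_mul (C / c)).const_add _)
    (fun s hs => by
      have h := hb _ (hmem s ⟨hs.1, hs.2.le⟩)
      have e1 : c * |x + s * (y - x) - x| = c * |y - x| * s := by
        rw [add_sub_cancel_left, abs_mul, abs_of_nonneg hs.1]; ring
      rw [e1] at h
      rw [norm_mul, Real.norm_eq_abs, Real.norm_eq_abs]
      have e2 : C / c * (Real.exp (c * |y - x| * s) * (c * |y - x|))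
        = C * Real.exp (c * |y - x| * s) * |y - x| := by field_simp
      rw [e2]
      exact mul_le_mul_of_nonneg_right h (abs_nonneg _))
  have := key (x := 1) ⟨zero_le_one, le_rfl⟩
  simpa using this

lemma mp_ratio (M : ℕ → ℝ) (hMpos : ∀ n, 0 < M n)
    (hconv : ∀ n : ℕ, (M (n + 1)) ^ 2 ≤ M n * M (n + 2)) (n N : ℕ) (h : n ≤ N) :
    M (n + 1) / M n ≤ M (N + 1) / M N := by
  have hm : Monotone (fun n => M (n + 1) / M n) := by
    apply monotone_nat_of_le_succ
    intro k
    rw [div_le_div_iff₀ (hMpos _) (hMpos _)]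
    nlinarith [hconv k]
  exact hm h

/-- `P(k, L, x)`. -/
def MPP (M : ℕ → ℝ) (g : ℕ → ℝ → ℝ) (k : ℕ) (l : ℝ) (x : ℝ) : Prop :=
  ∀ n, k ≤ n → |g n x| ≤ Real.exp (l + n) * M n

lemma mp_step (a b : ℝ) (M : ℕ → ℝ) (hMpos : ∀ n, 0 < M n)
    (hconv : ∀ n : ℕ, (M (n + 1)) ^ 2 ≤ M n * M (n + 2))
    (g : ℕ → ℝ → ℝ)
    (hg : ∀ n, ∀ t ∈ Icc a b, HasDerivWithinAt (g n) (g (n + 1) t) (Icc a b) t)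
    (hbound : ∀ n, ∀ t ∈ Icc a b, |g n t| ≤ M n)
    (k N : ℕ) (l x : ℝ) (hx : x ∈ Icc a b) (hl : -((N : ℝ) + 1) ≤ l)
    (hP : MPP M g k l x) (y : ℝ) (hy : y ∈ Icc a b) :
    MPP M g k (l + Real.exp 1 * (M (N + 1) / M N) * |y - x|) y := by
  set c := Real.exp 1 * (M (N + 1) / M N) with hcdef
  have hc : 0 < c := mul_pos (Real.exp_pos _) (div_pos (hMpos _) (hMpos _))
  have hbig : ∀ n, N + 1 ≤ n → ∀ y ∈ Icc a b, |g n y| ≤ Real.exp (l + c * |y - x| + n) * M n := by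
    intro n hn y hy
    refine (hbound n y hy).trans ?_
    have h1 : (N : ℝ) + 1 ≤ n := by exact_mod_cast hn
    have : 1 ≤ Real.exp (l + c * |y - x| + n) := by
      apply Real.one_le_exp
      have := mul_nonneg hc.le (abs_nonneg (y - x))
      linarith
    nlinarith [hMpos n]
  have main : ∀ j n, n + j = N + 1 → k ≤ n → ∀ y ∈ Icc a b,
      |g n y| ≤ Real.exp (l + c * |y - x| + n) * M n := by
    intro j
    induction j with
    | zero => intro n hn _; exact hbig n (by omega)
    | succ j ih =>
      intro n hn hk y hy
      have h1 := ih (n + 1) (by omega) (by omega)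
      have h2 := mp_scalar a b (g n) (g (n + 1)) (hg n) x y hx hy
        (Real.exp (l + (n + 1)) * M (n + 1)) c hc (by
          intro t ht
          refine (h1 t ht).trans (le_of_eq ?_)
          push_cast
          rw [show l + c * |t - x| + ((n : ℝ) + 1) = (l + (n + 1)) + c * |t - x| by ring, Real.exp_add]
          ring)
      have h3 := hP n hk
      have hr := mp_ratio M hMpos hconv n N (by omega)
      have h4 : Real.exp (l + (n + 1)) * M (n + 1) / c ≤ Real.exp (l + n) * M n := by
        rw [div_le_iff₀ hc, hcdef]
        rw [div_le_iff₀ (hMpos n)] at hr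
        rw [show l + ((n : ℝ) + 1) = (l + n) + 1 by ring, Real.exp_add]
        calc _ ≤ Real.exp (l + n) * Real.exp 1 * (M (N + 1) / M N * M n) := by gcongr
          _ = _ := by ring
      have h5 : 0 ≤ Real.exp (c * |y - x|) - 1 := by
        have := Real.one_le_exp (mul_nonneg hc.le (abs_nonneg (y - x)))
        linarith
      have h6 := mul_le_mul_of_nonneg_right h4 h5
      rw [show l + c * |y - x| + (n : ℝ) = (l + n) + c * |y - x| by ring, Real.exp_add]
      nlinarith
  intro n hn
  by_cases h : N + 1 ≤ n
  · exact hbig n h y hy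
  · exact main (N + 1 - n) n (by omega) hn y hy

/-- Budget state: `r` is a lower bound for the remaining budget before level `-N0`. -/
def MPR (M : ℕ → ℝ) (g : ℕ → ℝ → ℝ) (N0 k : ℕ) (r x : ℝ) : Prop :=
  ∃ N : ℕ, ∃ u : ℝ, N0 ≤ N ∧ 0 ≤ u ∧ u ≤ 1 ∧ MPP M g k (u - (N + 1)) x ∧
    r ≤ ∑ i ∈ Finset.range (N + 1), M i / M (i + 1) - ∑ i ∈ Finset.range N0, M i / M (i + 1)
      - u * (M N / M (N + 1))

lemma mp_move (a b : ℝ) (M : ℕ → ℝ) (hMpos : ∀ n, 0 < M n)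
    (hconv : ∀ n : ℕ, (M (n + 1)) ^ 2 ≤ M n * M (n + 2))
    (g : ℕ → ℝ → ℝ)
    (hg : ∀ n, ∀ t ∈ Icc a b, HasDerivWithinAt (g n) (g (n + 1) t) (Icc a b) t)
    (hbound : ∀ n, ∀ t ∈ Icc a b, |g n t| ≤ M n)
    (N0 k : ℕ) (r x y : ℝ) (hx : x ∈ Icc a b) (hy : y ∈ Icc a b)
    (hR : MPR M g N0 k r x) (hr : Real.exp 1 * |y - x| ≤ r) :
    MPR M g N0 k (r - Real.exp 1 * |y - x|) y := by
  obtain ⟨N, u, hN, hu0, hu1, hP, hrr⟩ := hR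
  obtain ⟨j, rfl⟩ := Nat.exists_eq_add_of_le hN
  clear hN
  induction j generalizing u x r with
  | zero =>
    set m := M (N0 + 0) / M (N0 + 0 + 1) with hm
    have hmpos : 0 < m := div_pos (hMpos _) (hMpos _)
    have hinv : M (N0 + 0 + 1) / M (N0 + 0) = 1 / m := by rw [hm, one_div_div]
    have h := mp_step a b M hMpos hconv g hg hbound k (N0 + 0) _ x hx (by linarith) hP y hy
    rw [hinv] at h
    have hs : ∑ i ∈ Finset.range (N0 + 0 + 1), M i / M (i + 1)
      = ∑ i ∈ Finset.range N0, M i / M (i + 1) + m := by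
      rw [Finset.sum_range_succ]; rfl
    have e : Real.exp 1 * (1 / m) * |y - x| = Real.exp 1 * |y - x| / m := by ring
    rw [e] at h
    have hq : 0 ≤ Real.exp 1 * |y - x| / m := by positivity
    have hq' : Real.exp 1 * |y - x| / m * m = Real.exp 1 * |y - x| := by field_simp
    refine ⟨N0 + 0, u + Real.exp 1 * |y - x| / m, by omega, by linarith, ?_, ?_, ?_⟩
    · by_contra hcon
      push Not at hcon
      nlinarith
    · convert h using 1; ring
    · rw [← hm, add_mul, hq']; linarith
  | succ j ih =>
    set m := M (N0 + (j + 1)) / M (N0 + (j + 1) + 1) with hm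
    have hmpos : 0 < m := div_pos (hMpos _) (hMpos _)
    have hinv : M (N0 + (j + 1) + 1) / M (N0 + (j + 1)) = 1 / m := by rw [hm, one_div_div]
    have hst := mp_step a b M hMpos hconv g hg hbound k (N0 + (j + 1)) _ x hx (by linarith) hP
    rw [hinv] at hst
    have e : ∀ z, Real.exp 1 * (1 / m) * |z - x| = Real.exp 1 * |z - x| / m := by intro z; ring
    have hq : 0 ≤ Real.exp 1 * |y - x| / m := by positivity
    have hq' : Real.exp 1 * |y - x| / m * m = Real.exp 1 * |y - x| := by field_simp
    by_cases hcase : u + Real.exp 1 * |y - x| / m ≤ 1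
    · have h := hst y hy
      rw [e] at h
      refine ⟨N0 + (j + 1), u + Real.exp 1 * |y - x| / m, by omega, by linarith, hcase, ?_, ?_⟩
      · convert h using 1; ring
      · rw [← hm, add_mul, hq']; linarith
    · push Not at hcase
      -- intermediate point
      set q := Real.exp 1 * |y - x| / m with hqdef
      have hqpos : 0 < q := by linarith
      set θ := (1 - u) / q with hθ
      have hθq : θ * q = 1 - u := by rw [hθ]; field_simp
      have hθ0 : 0 ≤ θ := div_nonneg (by linarith) hq
      have hθ1 : θ ≤ 1 := by rw [hθ, div_le_one hqpos]; linarith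
      have hz : x + θ * (y - x) ∈ Icc a b := by
        obtain ⟨hx0, hx1⟩ := hx
        obtain ⟨hy0, hy1⟩ := hy
        constructor <;> nlinarith
      have h := hst _ hz
      have ez : |x + θ * (y - x) - x| = θ * |y - x| := by
        rw [add_sub_cancel_left, abs_mul, abs_of_nonneg hθ0]
      have ey : |y - (x + θ * (y - x))| = (1 - θ) * |y - x| := by
        rw [show y - (x + θ * (y - x)) = (1 - θ) * (y - x) by ring, abs_mul,
          abs_of_nonneg (by linarith : 0 ≤ 1 - θ)]
      rw [e, ez, show Real.exp 1 * (θ * |y - x|) / m = θ * q by rw [hqdef]; ring, hθq] at h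
      have hed : Real.exp 1 * (θ * |y - x|) = (1 - u) * m := by
        rw [← hθq, mul_assoc, hq']; ring
      have h7 := ih (r - Real.exp 1 * (θ * |y - x|)) (x + θ * (y - x)) hz
        (by rw [ey]; linarith) 0 le_rfl zero_le_one (by
          convert h using 1; push_cast; ring) (by
          rw [hed]
          have hs : ∑ i ∈ Finset.range (N0 + (j + 1) + 1), M i / M (i + 1)
            = ∑ i ∈ Finset.range (N0 + j + 1), M i / M (i + 1) + m := by
            rw [Finset.sum_range_succ]; rfl
          rw [hs] at hrr
          linarith)
      rw [ey] at h7
      convert h7 using 1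
      ring

lemma mp_down (a b : ℝ) (g : ℕ → ℝ → ℝ)
    (hg : ∀ n, ∀ t ∈ Icc a b, HasDerivWithinAt (g n) (g (n + 1) t) (Icc a b) t)
    (hpos : ∀ n, 0 < g n a) (k : ℕ) (x : ℝ) (hx : x ∈ Icc a b) (h0 : g k x = 0) :
    ∃ y ∈ Icc a x, g (k + 1) y = 0 := by
  have hax : a < x := by
    rcases hx.1.lt_or_eq with h | h
    · exact h
    · subst h; have := hpos k; linarith
  have hcont : ∀ n, ContinuousOn (g n) (Icc a b) := fun n t ht => (hg n t ht).continuousWithinAt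
  have hsub : Icc a x ⊆ Icc a b := Icc_subset_Icc_right hx.2
  obtain ⟨c, hc, hc'⟩ := exists_hasDerivAt_eq_slope (g k) (g (k + 1)) hax ((hcont k).mono hsub)
    (fun t ht => (hg k t (hsub ⟨ht.1.le, ht.2.le⟩)).hasDerivAt
      (Icc_mem_nhds ht.1 (ht.2.trans_le hx.2)))
  have hneg : g (k + 1) c ≤ 0 := by
    rw [hc', h0]
    apply div_nonpos_of_nonpos_of_nonneg <;> linarith [hpos k]
  obtain ⟨y, hy, hy'⟩ := intermediate_value_Icc' hc.1.le
    ((hcont (k + 1)).mono ((Icc_subset_Icc_right hc.2.le).trans hsub)) ⟨hneg, (hpos (k + 1)).le⟩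
  exact ⟨y, ⟨hy.1, hy.2.trans hc.2.le⟩, hy'⟩

lemma mp_climb (a b : ℝ) (M : ℕ → ℝ) (hMpos : ∀ n, 0 < M n)
    (hconv : ∀ n : ℕ, (M (n + 1)) ^ 2 ≤ M n * M (n + 2))
    (g : ℕ → ℝ → ℝ)
    (hg : ∀ n, ∀ t ∈ Icc a b, HasDerivWithinAt (g n) (g (n + 1) t) (Icc a b) t)
    (hbound : ∀ n, ∀ t ∈ Icc a b, |g n t| ≤ M n) (hpos : ∀ n, 0 < g n a)
    (N0 N : ℕ) (hN : N0 ≤ N)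
    (S : ℝ) (hS : S = ∑ i ∈ Finset.range (N + 1), M i / M (i + 1)
      - ∑ i ∈ Finset.range N0, M i / M (i + 1))
    (hbud : Real.exp 1 * (b - a) ≤ S) :
    ∀ j k x, k + j = N + 1 → x ∈ Icc a b → g k x = 0 →
      MPR M g N0 k (S - Real.exp 1 * (x - a)) x := by
  have he := Real.exp_pos 1
  intro j
  induction j with
  | zero =>
    intro k x hk hx _
    refine ⟨N, 0, hN, le_rfl, zero_le_one, ?_, ?_⟩
    · intro n hn
      refine (hbound n x hx).trans ?_
      have h1 : (N : ℝ) + 1 ≤ n := by exact_mod_cast (by omega : N + 1 ≤ n)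
      have : 1 ≤ Real.exp (0 - ((N : ℝ) + 1) + n) := Real.one_le_exp (by linarith)
      nlinarith [hMpos n]
    · have := mul_nonneg he.le (sub_nonneg.2 hx.1)
      rw [← hS]; linarith
  | succ j ih =>
    intro k x hk hx h0
    obtain ⟨y, hy, hy0⟩ := mp_down a b g hg hpos k x hx h0
    have hyb : y ∈ Icc a b := ⟨hy.1, hy.2.trans hx.2⟩
    have h1 := ih (k + 1) y (by omega) hyb hy0
    have hxy : |x - y| = x - y := abs_of_nonneg (by linarith [hy.2])
    have h2 := mp_move a b M hMpos hconv g hg hbound N0 (k + 1) _ y x hyb hx h1 (by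
      rw [hxy]
      have := mul_le_mul_of_nonneg_left (sub_le_sub_right hx.2 a) he.le
      linarith)
    rw [hxy] at h2
    obtain ⟨N', u, hN', hu0, hu1, hP, hrr⟩ := h2
    refine ⟨N', u, hN', hu0, hu1, ?_, ?_⟩
    · intro n hn
      rcases hn.eq_or_lt with h | h
      · subst h
        rw [h0, abs_zero]
        exact mul_nonneg (Real.exp_pos _).le (hMpos _).le
      · exact hP n h
    · linarith

lemma mp_nozero (a b : ℝ) (M : ℕ → ℝ) (hMpos : ∀ n, 0 < M n)
    (hconv : ∀ n : ℕ, (M (n + 1)) ^ 2 ≤ M n * M (n + 2))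
    (hdiv : ¬ Summable (fun n : ℕ => M n / M (n + 1)))
    (g : ℕ → ℝ → ℝ)
    (hg : ∀ n, ∀ t ∈ Icc a b, HasDerivWithinAt (g n) (g (n + 1) t) (Icc a b) t)
    (hbound : ∀ n, ∀ t ∈ Icc a b, |g n t| ≤ M n) (hpos : ∀ n, 0 < g n a)
    (n : ℕ) (x : ℝ) (hx : x ∈ Icc a b) : g n x ≠ 0 := by
  intro h0
  have he := Real.exp_pos 1
  have ha : a ∈ Icc a b := ⟨le_rfl, hx.1.trans hx.2⟩
  have key : ∀ N0 : ℕ, |g n a| ≤ Real.exp (-(N0 : ℝ) + n) * M n := by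
    intro N0
    have ht := (not_summable_iff_tendsto_nat_atTop_of_nonneg
      (fun i => (div_pos (hMpos i) (hMpos (i + 1))).le)).1 hdiv
    have ht' := (Filter.tendsto_add_atTop_iff_nat 1).2 ht
    obtain ⟨N, hN1, hN2⟩ := ((ht'.eventually_ge_atTop
      (2 * (Real.exp 1 * (b - a)) + ∑ i ∈ Finset.range N0, M i / M (i + 1))).and
      (Filter.eventually_ge_atTop (N0 + n))).exists
    have hba : 0 ≤ Real.exp 1 * (b - a) := mul_nonneg he.le (by linarith [hx.1, hx.2])
    have h1 := mp_climb a b M hMpos hconv g hg hbound hpos N0 N (by omega) _ rfl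
      (by linarith) (N + 1 - n) n x (by omega) hx h0
    have hax : |a - x| = x - a := by rw [abs_sub_comm]; exact abs_of_nonneg (by linarith [hx.1])
    have hxb := mul_le_mul_of_nonneg_left (sub_le_sub_right hx.2 a) he.le
    have h2 := mp_move a b M hMpos hconv g hg hbound N0 n _ x a hx ha h1 (by
      rw [hax]; linarith)
    obtain ⟨N', u, hN', hu0, hu1, hP, -⟩ := h2
    refine (hP n le_rfl).trans ?_
    have : (N0 : ℝ) ≤ N' := by exact_mod_cast hN'
    have := (hMpos n).le
    gcongr
    linarith
  have hlim : Filter.Tendsto (fun N0 : ℕ => Real.exp (-(N0 : ℝ) + n) * M n) Filter.atTop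
      (nhds (0 * M n)) := by
    refine Filter.Tendsto.mul_const _ (Real.tendsto_exp_atBot.comp ?_)
    exact Filter.tendsto_atBot_add_const_right _ _
      (Filter.tendsto_neg_atTop_atBot.comp tendsto_natCast_atTop_atTop)
  have := ge_of_tendsto' hlim key
  have h3 := abs_pos_of_pos (hpos n)
  linarith

/-- Monotonicity property: let `M` be log-convex with `M 0 = 1` and `∑ M_{n-1}/M_n = ∞`.
If a `C^∞` function `f` on `[a,b]` satisfies `|f^(n)| ≤ M n` on `[a,b]` and
`f^(n)(a) > 0` for all `n`, then `f^(n)(x) > 0` for all `n` and all `x ∈ [a,b]`. -/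
theorem monotonicity_property
    (a b : ℝ) (hab : a < b)
    (M : ℕ → ℝ) (hMpos : ∀ n, 0 < M n) (hM0 : M 0 = 1)
    (hconv : ∀ n : ℕ, (M (n + 1)) ^ 2 ≤ M n * M (n + 2))
    (hdiv : ¬ Summable (fun n : ℕ => M n / M (n + 1)))
    (f : ℝ → ℝ) (hf : ContDiffOn ℝ (⊤ : ℕ∞) f (Set.Icc a b))
    (hbound : ∀ n : ℕ, ∀ t ∈ Set.Icc a b,
        |iteratedDerivWithin n f (Set.Icc a b) t| ≤ M n)
    (hpos : ∀ n : ℕ, 0 < iteratedDerivWithin n f (Set.Icc a b) a) :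
    ∀ n : ℕ, ∀ x ∈ Set.Icc a b, 0 < iteratedDerivWithin n f (Set.Icc a b) x := by
  have hg : ∀ n, ∀ t ∈ Icc a b, HasDerivWithinAt (iteratedDerivWithin n f (Icc a b))
      (iteratedDerivWithin (n + 1) f (Icc a b) t) (Icc a b) t := by
    intro n t ht
    rw [iteratedDerivWithin_succ]
    exact ((hf.differentiableOn_iteratedDerivWithin
      (by exact_mod_cast ENat.coe_lt_top n) (uniqueDiffOn_Icc hab)) t ht).hasDerivWithinAt
  intro n x hx
  by_contra hcon
  push Not at hcon
  have hcont : ContinuousOn (iteratedDerivWithin n f (Icc a b)) (Icc a x) := fun t ht =>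
    ((hg n t ⟨ht.1, ht.2.trans hx.2⟩).continuousWithinAt).mono (Icc_subset_Icc_right hx.2)
  obtain ⟨y, hy, hy'⟩ := intermediate_value_Icc' hx.1 hcont ⟨hcon, (hpos n).le⟩
  exact mp_nozero a b M hMpos hconv hdiv (fun n => iteratedDerivWithin n f (Icc a b)) hg hbound
    hpos n y ⟨hy.1, hy.2.trans hx.2⟩ hy'
end

section
/- Let f be a C^∞ function on [a,b] ⊂ ℝ (a < b) such that liminf_{n→∞} (M_n(f))^{1/n}/n < ∞, where M_n(f) = sup_{x∈[a,b]} |f^{(n)}(x)|. If c ∈ [a,b] is such that f^{(n)}(c) = 0 for all n ∈ ℕ, then f is identically zero on [a,b]. -/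
open Set Filter


lemma taylor_aux (a b c M : ℝ) (hc : c ∈ Set.Icc a b) (j : ℕ) :
    ∀ g : ℕ → ℝ → ℝ,
      (∀ k, ∀ x ∈ Set.Icc a b, HasDerivWithinAt (g k) (g (k+1) x) (Set.Icc a b) x) →
      (∀ k, g k c = 0) → (∀ x ∈ Set.Icc a b, |g j x| ≤ M) →
      ∀ x ∈ Set.Icc a b, |g 0 x| ≤ M * |x - c| ^ j / (j.factorial : ℝ) := by
  induction j with
  | zero =>
    intro g _ _ hM x hx
    simpa using hM x hx
  | succ j ih =>
    intro g hg h0 hM x hx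
    have ih' := ih (fun k => g (k+1)) (fun k => hg (k+1)) (fun k => h0 (k+1)) hM
    have hmem : ∀ t ∈ Set.Icc (0:ℝ) 1, c + t * (x - c) ∈ Set.Icc a b := by
      intro t ht
      obtain ⟨h1, h2⟩ := hc
      obtain ⟨h3, h4⟩ := hx
      obtain ⟨h5, h6⟩ := ht
      constructor <;> nlinarith
    have hd : ∀ t ∈ Set.Icc (0:ℝ) 1,
        HasDerivWithinAt (fun t => g 0 (c + t * (x - c)))
          (g 1 (c + t * (x - c)) * (x - c)) (Set.Icc 0 1) t := by
      intro t ht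
      have h1 := hg 0 _ (hmem t ht)
      have h2 : HasDerivWithinAt (fun t : ℝ => c + t * (x - c)) (x - c) (Set.Icc 0 1) t := by
        simpa using (((hasDerivAt_id t).mul_const (x - c)).const_add c).hasDerivWithinAt
      exact h1.comp t h2 hmem
    have key := image_norm_le_of_norm_deriv_right_le_deriv_boundary
      (f := fun t => g 0 (c + t * (x - c)))
      (f' := fun t => g 1 (c + t * (x - c)) * (x - c)) (a := 0) (b := 1)
      (B := fun t => M * |x - c| ^ (j+1) / ((j+1).factorial : ℝ) * t ^ (j+1))
      (B' := fun t => M * |x - c| ^ (j+1) / ((j+1).factorial : ℝ) * (((j+1 : ℕ):ℝ) * t ^ j))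
      (fun t ht => (hd t ht).continuousWithinAt)
      (fun t ht => ((hd t ⟨ht.1, ht.2.le⟩).mono_of_mem_nhdsWithin
        (Icc_mem_nhdsGE_of_mem ht)))
      (by simp [h0]) (fun t => by
        simpa using (hasDerivAt_pow (j+1) t).const_mul _) (by
        intro t ht
        have h1 := ih' _ (hmem t ⟨ht.1, ht.2.le⟩)
        simp only [zero_add] at h1
        rw [norm_mul, Real.norm_eq_abs, Real.norm_eq_abs]
        refine (mul_le_mul_of_nonneg_right h1 (abs_nonneg _)).trans (le_of_eq ?_)
        rw [add_sub_cancel_left, abs_mul, abs_of_nonneg ht.1, Nat.factorial_succ]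
        push_cast
        have : (j.factorial : ℝ) ≠ 0 := by positivity
        have : (j : ℝ) + 1 ≠ 0 := by positivity
        field_simp
        ring)
    have := key (x := 1) (by simp)
    simpa using this

/-- If `f` is `C^∞` on `[a,b]` with `liminf (M_n(f))^{1/n} / n < ∞`, where
`M_n(f) = sup_{x ∈ [a,b]} |f^(n)(x)|`, and `f^(n)(c) = 0` for all `n` at some
`c ∈ [a,b]`, then `f` vanishes identically on `[a,b]`. -/
theorem vanishing_of_liminf_root_div_lt_top
    (a b : ℝ) (hab : a < b)
    (f : ℝ → ℝ) (hf : ContDiffOn ℝ (⊤ : ℕ∞) f (Set.Icc a b))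
    (Mf : ℕ → ℝ)
    (hMf : ∀ n : ℕ, Mf n = ⨆ x : Set.Icc a b,
        |iteratedDerivWithin n f (Set.Icc a b) x|)
    (hliminf : Filter.liminf
        (fun n : ℕ => ENNReal.ofReal (Mf n ^ (((n : ℕ) : ℝ)⁻¹) / (n : ℝ)))
        Filter.atTop < ⊤)
    (c : ℝ) (hc : c ∈ Set.Icc a b)
    (hzero : ∀ n : ℕ, iteratedDerivWithin n f (Set.Icc a b) c = 0) :
    ∀ x ∈ Set.Icc a b, f x = 0 := by
  have hud : UniqueDiffOn ℝ (Set.Icc a b) := uniqueDiffOn_Icc hab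
  have hder : ∀ k, ∀ x ∈ Set.Icc a b, HasDerivWithinAt (iteratedDerivWithin k f (Set.Icc a b))
      (iteratedDerivWithin (k+1) f (Set.Icc a b) x) (Set.Icc a b) x := by
    intro k x hx
    rw [iteratedDerivWithin_succ]
    exact (hf.differentiableOn_iteratedDerivWithin
      (by exact_mod_cast ENat.natCast_lt_top k) hud x hx).hasDerivWithinAt
  have hbd : ∀ n, ∀ x ∈ Set.Icc a b, |iteratedDerivWithin n f (Set.Icc a b) x| ≤ Mf n := by
    intro n x hx
    rw [hMf]
    have hcont : ContinuousOn (fun x => |iteratedDerivWithin n f (Set.Icc a b) x|)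
        (Set.Icc a b) := fun y hy => (hder n y hy).continuousWithinAt.abs
    have hB := isCompact_Icc.bddAbove_image hcont
    refine le_ciSup (f := fun x : Set.Icc a b => |iteratedDerivWithin n f (Set.Icc a b) x|)
      ?_ ⟨x, hx⟩
    rwa [Set.image_eq_range] at hB
  have hM0 : ∀ n, 0 ≤ Mf n := fun n => (abs_nonneg _).trans (hbd n c hc)
  obtain ⟨C', hC1, hC2⟩ := exists_between hliminf
  lift C' to NNReal using hC2.ne
  obtain ⟨C, hC, hfreq⟩ : ∃ C : ℝ, 0 < C ∧ ∃ᶠ n : ℕ in atTop, Mf n ≤ (C * n) ^ n := by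
    refine ⟨(C' : ℝ) + 1, by positivity, ?_⟩
    refine ((frequently_lt_of_liminf_lt (h := hC1)).and_eventually
      (eventually_ge_atTop 1)).mono ?_
    rintro n ⟨hn, hn1⟩
    have hnpos : (0:ℝ) < n := by exact_mod_cast hn1
    have h1 : Mf n ^ ((n:ℝ)⁻¹) / n < C' := by
      rw [ENNReal.ofReal_lt_coe_iff (by have := hM0 n; positivity)] at hn
      exact hn
    have h2 : Mf n ^ ((n:ℝ)⁻¹) ≤ ((C' : ℝ) + 1) * n := by
      rw [div_lt_iff₀ hnpos] at h1
      nlinarith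
    calc Mf n = (Mf n ^ ((n:ℝ)⁻¹)) ^ n := (Real.rpow_inv_natCast_pow (hM0 n) (by omega)).symm
      _ ≤ _ := pow_le_pow_left₀ (Real.rpow_nonneg (hM0 n) _) h2 n
  set K := C * Real.exp 1 with hK
  have hKpos : 0 < K := by positivity
  set r := 1 / (2 * K) with hr
  have hrpos : 0 < r := by positivity
  have hloc : ∀ y ∈ Set.Icc a b, (∀ n, iteratedDerivWithin n f (Set.Icc a b) y = 0) →
      ∀ x ∈ Set.Icc a b, |x - y| < r → f x = 0 := by
    intro y hy hy0 x hx hxy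
    by_contra hne
    have hpos : 0 < |f x| := abs_pos.mpr hne
    have hev : ∀ᶠ n : ℕ in atTop, (1/2 : ℝ) ^ n < |f x| :=
      (tendsto_pow_atTop_nhds_zero_of_lt_one (by norm_num) (by norm_num)).eventually_lt_const hpos
    obtain ⟨n, hn, hn2⟩ := (hfreq.and_eventually hev).exists
    have ht := taylor_aux a b y (Mf n) hy n (fun k => iteratedDerivWithin k f (Set.Icc a b))
      hder hy0 (hbd n) x hx
    simp only [iteratedDerivWithin_zero] at ht
    have he := Real.pow_div_factorial_le_exp (x := n) (by positivity) n
    have : |f x| ≤ (1/2) ^ n := by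
      calc |f x| ≤ Mf n * |x - y| ^ n / (n.factorial : ℝ) := ht
        _ ≤ (C * n) ^ n * |x - y| ^ n / (n.factorial : ℝ) := by gcongr
        _ = C ^ n * |x - y| ^ n * ((n:ℝ) ^ n / (n.factorial : ℝ)) := by rw [mul_pow]; ring
        _ ≤ C ^ n * |x - y| ^ n * Real.exp n := by gcongr
        _ = (K * |x - y|) ^ n := by
          rw [← Real.exp_one_pow n, hK]; ring
        _ ≤ (K * r) ^ n := by gcongr
        _ = (1/2) ^ n := by
          congr 1
          rw [hr]; field_simp
    linarith
  have hstep : ∀ y ∈ Set.Icc a b, (∀ n, iteratedDerivWithin n f (Set.Icc a b) y = 0) →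
      ∀ x ∈ Set.Icc a b, |x - y| < r → ∀ n, iteratedDerivWithin n f (Set.Icc a b) x = 0 := by
    intro y hy hy0 x hx hxy n
    have hev : f =ᶠ[nhdsWithin x (Set.Icc a b)] (fun _ => (0:ℝ)) := by
      have h1 : ∀ᶠ z in nhds x, |z - y| < r :=
        (by fun_prop : Continuous fun z : ℝ => |z - y|).continuousAt.eventually_lt_const hxy
      filter_upwards [self_mem_nhdsWithin, nhdsWithin_le_nhds h1] with z hz hz1
      exact hloc y hy hy0 z hz hz1
    rw [hev.iteratedDerivWithin_eq (hloc y hy hy0 x hx hxy)]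
    simp
  have hall : ∀ k : ℕ, ∀ x ∈ Set.Icc a b, |x - c| ≤ k * (r / 2) →
      ∀ n, iteratedDerivWithin n f (Set.Icc a b) x = 0 := by
    intro k
    induction k with
    | zero =>
      intro x hx h
      have : x = c := by
        have h' : |x - c| ≤ 0 := by simpa using h
        exact sub_eq_zero.mp (abs_nonpos_iff.mp h')
      rw [this]; exact hzero
    | succ k ih =>
      intro x hx h
      push_cast at h
      have hk : (0:ℝ) < (k:ℝ) + 1 := by positivity
      have hs1 : |x - c| / ((k:ℝ) + 1) ≤ r / 2 := by
        rw [div_le_iff₀ hk]; linarith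
      have hy : c + (k / ((k:ℝ) + 1)) * (x - c) ∈ Set.Icc a b := by
        have h5 : (0:ℝ) ≤ k / ((k:ℝ) + 1) := by positivity
        have h6 : k / ((k:ℝ) + 1) ≤ 1 := by rw [div_le_one hk]; linarith
        obtain ⟨h1, h2⟩ := hc
        obtain ⟨h3, h4⟩ := hx
        constructor <;> nlinarith
      refine hstep _ hy (ih _ hy ?_) x hx ?_
      · rw [add_sub_cancel_left, abs_mul, abs_of_nonneg (by positivity)]
        calc (k / ((k:ℝ) + 1)) * |x - c| = k * (|x - c| / ((k:ℝ) + 1)) := by ring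
          _ ≤ _ := by gcongr
      · have : x - (c + (k / ((k:ℝ) + 1)) * (x - c)) = (x - c) / ((k:ℝ) + 1) := by
          field_simp; ring
        rw [this, abs_div, abs_of_pos hk]
        linarith
  intro x hx
  obtain ⟨k, hk⟩ := exists_nat_ge (|x - c| / (r / 2))
  have := hall k x hx ((div_le_iff₀ (by positivity)).mp hk) 0
  simpa using this
end

section
/- Let Q_n denote the Abel–Gontcharoff polynomials. For every n ≥ 1, every 0 ≤ k < n, all real numbers x, y, x_0, x_1, …, x_{n-1}: Q_n(x, x_0, x_1, …, x_{n-1}) − Q_n(x, x_0, …, x_{k-1}, y, x_{k+1}, …, x_{n-1}) = Q_k(x, x_0, x_1, …, x_{k-1}) · Q_{n-k}(y, x_k, x_{k+1}, …, x_{n-1}). -/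
/-- The Abel–Gontcharoff polynomials: `Q 0 x _ = 1` and
`Q (n+1) x (x₀,…,xₙ) = ∫_{x₀}^{x} Q n t (x₁,…,xₙ) dt`. -/
noncomputable def abelGontcharoff : (n : ℕ) → ℝ → (Fin n → ℝ) → ℝ
  | 0, _, _ => 1
  | n + 1, x, xs => ∫ t in (xs 0)..x, abelGontcharoff n t (Fin.tail xs)

theorem abelGontcharoff_cont (n : ℕ) : ∀ xs : Fin n → ℝ,
    Continuous (fun x => abelGontcharoff n x xs) := by
  induction n with
  | zero => intro xs; simp only [abelGontcharoff]; exact continuous_const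
  | succ n ih =>
    intro xs
    simp only [abelGontcharoff]
    exact intervalIntegral.continuous_primitive
      (fun a b => (ih (Fin.tail xs)).intervalIntegrable a b) _

theorem abelGontcharoff_cast {m n : ℕ} (h : m = n) (x : ℝ) (f : Fin m → ℝ) (g : Fin n → ℝ)
    (hfg : ∀ i : Fin m, f i = g (Fin.cast h i)) :
    abelGontcharoff m x f = abelGontcharoff n x g := by
  subst h
  congr 1
  funext i
  exact hfg i

/-- Replacing the parameter `x_k` by `y` in the Abel–Gontcharoff polynomial `Q_n`:
`Q_n(x,x₀,…,x_{n-1}) − Q_n(x,x₀,…,x_{k-1},y,x_{k+1},…,x_{n-1})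
  = Q_k(x,x₀,…,x_{k-1}) · Q_{n-k}(y,x_k,…,x_{n-1})`. -/
theorem abelGontcharoff_update
    (n : ℕ) (hn : 1 ≤ n) (k : ℕ) (hk : k < n) (x y : ℝ) (xs : Fin n → ℝ) :
    abelGontcharoff n x xs - abelGontcharoff n x (Function.update xs ⟨k, hk⟩ y)
      = abelGontcharoff k x (fun i : Fin k => xs (Fin.castLE hk.le i))
        * abelGontcharoff (n - k) y
            (fun i : Fin (n - k) => xs ⟨k + (i : ℕ), by omega⟩) := by
  induction n generalizing k x with
  | zero => omega
  | succ n ih =>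
    have hint : ∀ (zs : Fin n → ℝ) (a b : ℝ), IntervalIntegrable
        (fun t => abelGontcharoff n t zs) MeasureTheory.volume a b :=
      fun zs a b => (abelGontcharoff_cont n zs).intervalIntegrable a b
    cases k with
    | zero =>
      have ht : Fin.tail (Function.update xs ⟨0, hk⟩ y) = Fin.tail xs :=
        Fin.tail_update_zero xs y
      have h0 : Function.update xs ⟨0, hk⟩ y 0 = y := by
        rw [show (⟨0, hk⟩ : Fin (n + 1)) = 0 from rfl]; simp
      rw [abelGontcharoff_cast (Nat.sub_zero (n+1)) y _ xs
        (by intro i; congr 1; ext; simp)]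
      simp only [abelGontcharoff, ht, h0, one_mul]
      rw [sub_eq_iff_eq_add, intervalIntegral.integral_add_adjacent_intervals] <;> apply hint
    | succ j =>
      have hj : j < n := by omega
      have ht : Fin.tail (Function.update xs ⟨j + 1, hk⟩ y)
          = Function.update (Fin.tail xs) ⟨j, hj⟩ y :=
        Fin.tail_update_succ xs ⟨j, hj⟩ y
      have h0 : Function.update xs ⟨j + 1, hk⟩ y 0 = xs 0 :=
        Function.update_of_ne (by simp [Fin.ext_iff]) y xs
      rw [abelGontcharoff_cast (Nat.add_sub_add_right n 1 j) y _
        (fun i : Fin (n - j) => Fin.tail xs ⟨j + (i : ℕ), by omega⟩)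
        (by intro i; simp only [Fin.tail]; congr 1; ext; simp; omega)]
      simp only [abelGontcharoff, ht, h0]
      rw [← intervalIntegral.integral_sub (hint _ _ _) (hint _ _ _),
        ← intervalIntegral.integral_mul_const]
      refine intervalIntegral.integral_congr (fun t _ => ?_)
      exact ih (by omega) j hj t (Fin.tail xs)
end

section
/- Let Q_n denote the Abel–Gontcharoff polynomials. For every n ≥ 1 and all real numbers x, x_0, …, x_{n-1}, y_0, …, y_{n-1}: Q_n(x, x_0, x_1, …, x_{n-1}) = Q_n(x, y_0, y_1, …, y_{n-1}) + ∑_{i=0}^{n-1} Q_i(x, y_0, y_1, …, y_{i-1}) · Q_{n-i}(y_i, x_i, x_{i+1}, …, x_{n-1}). -/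
theorem abelGontcharoff_congr {m k : ℕ} (h : m = k) (x : ℝ) (f : Fin m → ℝ) (g : Fin k → ℝ)
    (hfg : ∀ (j : ℕ) (h1 : j < m) (h2 : j < k), f ⟨j, h1⟩ = g ⟨j, h2⟩) :
    abelGontcharoff m x f = abelGontcharoff k x g := by
  subst h
  congr 1
  funext j
  exact hfg j j.2 j.2

theorem abelGontcharoff_aux (n : ℕ) : ∀ (x : ℝ) (xs ys : Fin n → ℝ)
    (hp : ∀ (i : Fin n) (j : Fin (n - (i : ℕ))), (i : ℕ) + (j : ℕ) < n),
    abelGontcharoff n x xs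
      = abelGontcharoff n x ys
        + ∑ i : Fin n,
            abelGontcharoff (i : ℕ) x
              (fun j : Fin (i : ℕ) => ys (Fin.castLE i.isLt.le j))
            * abelGontcharoff (n - (i : ℕ)) (ys i)
                (fun j : Fin (n - (i : ℕ)) => xs ⟨(i : ℕ) + (j : ℕ), hp i j⟩) := by
  induction n with
  | zero => intro x xs ys hp; simp [abelGontcharoff]
  | succ n ih =>
    intro x xs ys hp
    have hq : ∀ (i : Fin n) (j : Fin (n - (i : ℕ))), (i : ℕ) + (j : ℕ) < n := by
      intro i j
      have := j.2
      omega
    have hI : ∀ (m : ℕ) (zs : Fin m → ℝ) (a b : ℝ),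
        IntervalIntegrable (fun t => abelGontcharoff m t zs) MeasureTheory.volume a b :=
      fun m zs a b => (abelGontcharoff_cont m zs).intervalIntegrable a b
    rw [Fin.sum_univ_succ]
    have h0 : abelGontcharoff (n + 1 - ((0 : Fin (n + 1)) : ℕ)) (ys 0)
        (fun j : Fin (n + 1 - ((0 : Fin (n + 1)) : ℕ)) =>
          xs ⟨((0 : Fin (n + 1)) : ℕ) + (j : ℕ), hp 0 j⟩)
        = ∫ t in (xs 0)..(ys 0), abelGontcharoff n t (Fin.tail xs) := by
      rw [abelGontcharoff_congr (k := n + 1) (by simp) _ _ xs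
        (by intro j h1 h2; congr 1; simp)]
      rfl
    have h1 : abelGontcharoff ((0 : Fin (n + 1)) : ℕ) x
        (fun j => ys (Fin.castLE (0 : Fin (n + 1)).isLt.le j)) = 1 := rfl
    rw [h0, h1, one_mul]
    have h2 : ∀ i : Fin n,
        abelGontcharoff (i.succ : ℕ) x
          (fun j : Fin (i.succ : ℕ) => ys (Fin.castLE i.succ.isLt.le j))
        * abelGontcharoff (n + 1 - (i.succ : ℕ)) (ys i.succ)
            (fun j : Fin (n + 1 - (i.succ : ℕ)) =>
              xs ⟨(i.succ : ℕ) + (j : ℕ), hp i.succ j⟩)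
        = ∫ t in (ys 0)..x, abelGontcharoff (i : ℕ) t
              (fun j : Fin (i : ℕ) => Fin.tail ys (Fin.castLE i.isLt.le j))
            * abelGontcharoff (n - (i : ℕ)) (Fin.tail ys i)
                (fun j : Fin (n - (i : ℕ)) =>
                  Fin.tail xs ⟨(i : ℕ) + (j : ℕ), hq i j⟩) := by
      intro i
      rw [intervalIntegral.integral_mul_const]
      congr 1
      refine abelGontcharoff_congr (by simp) _ _ _ ?_
      intro j h1 h2
      simp only [Fin.tail]
      congr 1
      ext
      simp
      omega
    rw [Finset.sum_congr rfl (fun i _ => h2 i),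
      ← intervalIntegral.integral_finsetSum (fun i _ => (hI _ _ _ _).mul_const _)]
    have h3 : abelGontcharoff (n + 1) x xs
        = (∫ t in (xs 0)..(ys 0), abelGontcharoff n t (Fin.tail xs))
          + ∫ t in (ys 0)..x, abelGontcharoff n t (Fin.tail xs) :=
      (intervalIntegral.integral_add_adjacent_intervals (hI _ _ _ _) (hI _ _ _ _)).symm
    have h4 : abelGontcharoff (n + 1) x ys
        = ∫ t in (ys 0)..x, abelGontcharoff n t (Fin.tail ys) := rfl
    rw [h3, h4, add_left_comm, ← intervalIntegral.integral_add (hI _ _ _ _)]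
    · congr 1
      refine intervalIntegral.integral_congr (fun t _ => ?_)
      exact ih t (Fin.tail xs) (Fin.tail ys) hq
    · apply Continuous.intervalIntegrable
      exact continuous_finsetSum _
        (fun i _ => (abelGontcharoff_cont _ _).mul continuous_const)

/-- Change-of-parameters formula for the Abel–Gontcharoff polynomials:
`Q_n(x,x₀,…,x_{n-1}) = Q_n(x,y₀,…,y_{n-1})
  + ∑_{i=0}^{n-1} Q_i(x,y₀,…,y_{i-1}) · Q_{n-i}(y_i,x_i,…,x_{n-1})`. -/
theorem abelGontcharoff_change_of_parameters
    (n : ℕ) (hn : 1 ≤ n) (x : ℝ) (xs ys : Fin n → ℝ) :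
    abelGontcharoff n x xs
      = abelGontcharoff n x ys
        + ∑ i : Fin n,
            abelGontcharoff (i : ℕ) x
              (fun j : Fin (i : ℕ) => ys (Fin.castLE i.isLt.le j))
            * abelGontcharoff (n - (i : ℕ)) (ys i)
                (fun j : Fin (n - (i : ℕ)) => xs ⟨(i : ℕ) + (j : ℕ), by omega⟩) := by
  exact abelGontcharoff_aux n x xs ys (fun i j => by have := j.2; omega)
end

section
/- Let n̄ = (n_k)_{k∈ℕ} be a strictly increasing sequence of natural numbers and let f ∈ C_n̄([a,b]). Suppose there is a sequence (x_n)_{n∈ℕ} with x_n ∈ [a,b] and f^{(n)}(x_n) = 0 for all n ∈ ℕ. If the series ∑_{j=0}^∞ |x_j − x_{j+1}| converges, then f is identically zero on [a,b]. -/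
open Set
open scoped Nat

/-- Gontcharoff-type estimate. -/
lemma gont_core {a b : ℝ} (g : ℕ → ℝ → ℝ)
    (hg : ∀ n, ∀ t ∈ Icc a b, HasDerivWithinAt (g n) (g (n + 1) t) (Icc a b) t)
    (y : ℕ → ℝ) (hy : ∀ n, y n ∈ Icc a b) (M : ℝ) (p : ℕ) :
    ∀ m, (∀ i < p, g (m + i) (y (m + i)) = 0) → (∀ t ∈ Icc a b, |g (m + p) t| ≤ M) →
      ∀ t ∈ Icc a b, |g m t| ≤
        M * (|t - y m| + ∑ j ∈ Finset.range p, |y (m + j) - y (m + j + 1)|) ^ p / (p ! : ℝ) := by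
  induction p with
  | zero =>
    intro m _ hM t ht
    simpa using hM t ht
  | succ p ih =>
    intro m hz hM t ht
    have hM0 : 0 ≤ M := le_trans (abs_nonneg _) (hM t ht)
    have hfac : (0 : ℝ) < (p ! : ℝ) := by positivity
    have ih' := ih (m + 1)
      (fun i hi => by
        have := hz (i + 1) (by omega)
        rwa [show m + (i + 1) = m + 1 + i by ring] at this)
      (fun s hs => by
        have := hM s hs
        rwa [show m + (p + 1) = m + 1 + p by ring] at this)
    set D' := ∑ j ∈ Finset.range p, |y (m + 1 + j) - y (m + 1 + j + 1)| with hD'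
    have hD'0 : 0 ≤ D' := Finset.sum_nonneg fun _ _ => abs_nonneg _
    set D := ∑ j ∈ Finset.range (p + 1), |y (m + j) - y (m + j + 1)| with hD
    have hDD : D = D' + |y m - y (m + 1)| := by
      rw [hD, Finset.sum_range_succ', hD']
      congr 1
      apply Finset.sum_congr rfl
      intro j _
      rw [show m + (j + 1) = m + 1 + j by ring]
    have hD0 : 0 ≤ D := by rw [hDD]; positivity
    have hbound : ∀ s ∈ Icc a b, |g (m + 1) s| ≤ M * (|s - y m| + D) ^ p / (p ! : ℝ) := by
      intro s hs
      refine (ih' s hs).trans ?_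
      have : |s - y (m + 1)| ≤ |s - y m| + |y m - y (m + 1)| := abs_sub_le _ _ _
      have h2 : |s - y (m + 1)| + D' ≤ |s - y m| + D := by rw [hDD]; linarith
      have h3 : 0 ≤ |s - y (m + 1)| + D' := by positivity
      gcongr
    set c := |t - y m| with hc
    have hmem : ∀ u ∈ Icc (0 : ℝ) 1, y m + u * (t - y m) ∈ Icc a b := by
      intro u hu
      have := (convex_Icc a b).add_smul_sub_mem (hy m) ht hu
      simpa using this
    have hlin : ∀ u, HasDerivWithinAt (fun u : ℝ => y m + u * (t - y m)) (t - y m) (Icc 0 1) u := by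
      intro u
      have := (((hasDerivAt_id u).mul_const (t - y m)).const_add (y m)).hasDerivWithinAt (s := Icc 0 1)
      simpa using this
    have hφ : ∀ u ∈ Icc (0 : ℝ) 1, HasDerivWithinAt (fun u => g m (y m + u * (t - y m)))
        (g (m + 1) (y m + u * (t - y m)) * (t - y m)) (Icc 0 1) u := by
      intro u hu
      exact (hg m _ (hmem u hu)).comp u (hlin u) hmem
    have hB : ∀ u : ℝ, HasDerivAt (fun u => M * (u * c + D) ^ (p + 1) / ((p + 1)! : ℝ))
        (M * (u * c + D) ^ p / (p ! : ℝ) * c) u := by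
      intro u
      have h1 : HasDerivAt (fun u : ℝ => u * c + D) c u := by
        simpa using ((hasDerivAt_id u).mul_const c).add_const D
      have h2 := ((h1.pow (p + 1)).const_mul M).div_const ((p + 1)! : ℝ)
      refine h2.congr_deriv ?_
      rw [Nat.factorial_succ]
      push_cast
      have : (p : ℝ) + 1 ≠ 0 := by positivity
      field_simp
    have key := image_norm_le_of_norm_deriv_right_le_deriv_boundary
      (f := fun u => g m (y m + u * (t - y m)))
      (f' := fun u => g (m + 1) (y m + u * (t - y m)) * (t - y m))
      (a := 0) (b := 1) (fun u hu => (hφ u hu).continuousWithinAt)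
      (fun u hu => (hφ u (Ico_subset_Icc_self hu)).mono_of_mem_nhdsWithin
        (Icc_mem_nhdsGE_of_mem hu))
      (B := fun u => M * (u * c + D) ^ (p + 1) / ((p + 1)! : ℝ))
      (B' := fun u => M * (u * c + D) ^ p / (p ! : ℝ) * c)
      (by
        have := hz 0 (by omega)
        simp only [add_zero] at this
        simp only [zero_mul, add_zero, this, norm_zero]
        positivity)
      hB
      (by
        intro u hu
        rw [norm_mul, Real.norm_eq_abs, Real.norm_eq_abs]
        have h := hbound _ (hmem u (Ico_subset_Icc_self hu))
        rw [show y m + u * (t - y m) - y m = u * (t - y m) by ring, abs_mul,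
          abs_of_nonneg hu.1] at h
        exact mul_le_mul_of_nonneg_right h (abs_nonneg _))
      (right_mem_Icc.2 zero_le_one)
    simpa using key

/-- Local vanishing. -/
lemma gont_local {a b : ℝ} (g : ℕ → ℝ → ℝ)
    (hg : ∀ n, ∀ t ∈ Icc a b, HasDerivWithinAt (g n) (g (n + 1) t) (Icc a b) t)
    (nk : ℕ → ℕ) (hmono : StrictMono nk) (A B : ℝ) (hA : 0 < A) (hB : 0 < B)
    (hcl : ∀ k, ∀ t ∈ Icc a b, |g (nk k) t| ≤ B * A ^ (nk k) * ((nk k)! : ℝ))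
    (y : ℕ → ℝ) (hy : ∀ n, y n ∈ Icc a b) (m : ℕ) (hz : ∀ n, m ≤ n → g n (y n) = 0)
    (r : ℝ) (hr : 0 < r) (hAr : A * r < 1) (t : ℝ) (ht : t ∈ Icc a b)
    (hsum : ∀ p, |t - y m| + ∑ j ∈ Finset.range p, |y (m + j) - y (m + j + 1)| ≤ r) :
    g m t = 0 := by
  have hle : ∀ k, m ≤ nk k →
      |g m t| ≤ B * (r ^ m)⁻¹ * (((nk k : ℕ) : ℝ) ^ m * (A * r) ^ (nk k)) := by
    intro k hk
    obtain ⟨p, hp⟩ := Nat.exists_eq_add_of_le hk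
    have h := gont_core g hg y hy (B * A ^ (nk k) * ((nk k)! : ℝ)) p m
      (fun i _ => hz _ (by omega)) (fun s hs => by rw [← hp]; exact hcl k s hs) t ht
    refine h.trans ?_
    have h1 : (|t - y m| + ∑ j ∈ Finset.range p, |y (m + j) - y (m + j + 1)|) ^ p ≤ r ^ p :=
      pow_le_pow_left₀ (add_nonneg (abs_nonneg _) (Finset.sum_nonneg fun _ _ => abs_nonneg _))
        (hsum p) p
    have h2 : ((nk k)! : ℝ) ≤ (p ! : ℝ) * ((nk k : ℕ) : ℝ) ^ m := by
      have e := Nat.factorial_mul_descFactorial hk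
      rw [show nk k - m = p by omega] at e
      rw [← e]
      push_cast
      gcongr
      exact_mod_cast Nat.descFactorial_le_pow _ _
    rw [div_le_iff₀ (by positivity)]
    calc _ ≤ B * A ^ (nk k) * ((p ! : ℝ) * ((nk k : ℕ) : ℝ) ^ m) * r ^ p := by gcongr
      _ = _ := by
        rw [mul_pow]
        have : r ^ (nk k) = r ^ m * r ^ p := by rw [hp, pow_add]
        rw [this]
        field_simp
  have hlim := ((tendsto_pow_const_mul_const_pow_of_abs_lt_one m (r := A * r)
    (by rw [abs_of_pos (by positivity)]; exact hAr)).comp hmono.tendsto_atTop).const_mul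
      (B * (r ^ m)⁻¹)
  rw [mul_zero] at hlim
  have : |g m t| ≤ 0 := ge_of_tendsto hlim (by
    filter_upwards [hmono.tendsto_atTop.eventually_ge_atTop m] with k hk
    exact hle k hk)
  exact abs_eq_zero.1 (le_antisymm this (abs_nonneg _))

/-- Let `n̄ = (n_k)` be strictly increasing, `f ∈ C_n̄([a,b])` (i.e. there are `A, B > 0`
with `M_{n_k}(f) ≤ B·A^{n_k}·n_k!` for all `k`), and suppose `f^(n)(x_n) = 0` for a
sequence `(x_n) ⊂ [a,b]`. If `∑ |x_j − x_{j+1}|` converges, then `f ≡ 0` on `[a,b]`. -/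
theorem vanishing_in_class_of_sequence
    (a b : ℝ) (hab : a < b)
    (nk : ℕ → ℕ) (hmono : StrictMono nk)
    (f : ℝ → ℝ) (hf : ContDiffOn ℝ (⊤ : ℕ∞) f (Set.Icc a b))
    (hclass : ∃ A > (0 : ℝ), ∃ B > (0 : ℝ), ∀ k : ℕ, ∀ t ∈ Set.Icc a b,
        |iteratedDerivWithin (nk k) f (Set.Icc a b) t|
          ≤ B * A ^ (nk k) * ((nk k)! : ℝ))
    (x : ℕ → ℝ) (hx : ∀ n, x n ∈ Set.Icc a b)
    (hzero : ∀ n : ℕ, iteratedDerivWithin n f (Set.Icc a b) (x n) = 0)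
    (hconv : Summable (fun j : ℕ => |x j - x (j + 1)|)) :
    ∀ t ∈ Set.Icc a b, f t = 0 := by
  obtain ⟨A, hA, B, hB, hcl⟩ := hclass
  set g : ℕ → ℝ → ℝ := fun n => iteratedDerivWithin n f (Set.Icc a b) with hgdef
  have hg : ∀ n, ∀ t ∈ Icc a b, HasDerivWithinAt (g n) (g (n + 1) t) (Icc a b) t := by
    intro n t ht
    have hd := hf.differentiableOn_iteratedDerivWithin (m := n)
      (by exact_mod_cast WithTop.coe_lt_top (n : ℕ)) (uniqueDiffOn_Icc hab) t ht
    have := hd.hasDerivWithinAt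
    simpa only [hgdef, iteratedDerivWithin_succ] using this
  set δ : ℝ := 1 / (4 * A) with hδ
  have hδ0 : 0 < δ := by positivity
  have hAr : A * (2 * δ) < 1 := by
    rw [hδ]; field_simp; norm_num
  -- tail
  obtain ⟨m, hm⟩ : ∃ m, ∀ n, m ≤ n → ∀ p,
      ∑ j ∈ Finset.range p, |x (n + j) - x (n + j + 1)| ≤ δ := by
    have h := tendsto_sum_nat_add (fun j : ℕ => |x j - x (j + 1)|)
    obtain ⟨m, hm⟩ := Filter.eventually_atTop.1 (h.eventually_le_const hδ0)
    refine ⟨m, fun n hn p => le_trans ?_ (hm n hn)⟩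
    have hs := (summable_nat_add_iff n).2 hconv
    have := hs.sum_le_tsum (Finset.range p) (fun _ _ => abs_nonneg _)
    simpa only [add_comm, add_left_comm] using this
  have hdist : ∀ p, |x m - x (m + p)| ≤ δ := by
    intro p
    refine le_trans ?_ (hm m le_rfl p)
    induction p with
    | zero => simp
    | succ p ih =>
      rw [Finset.sum_range_succ]
      exact (abs_sub_le _ (x (m + p)) _).trans (by
        rw [← add_assoc]; linarith)
  have hstart : ∀ n, m ≤ n → g n (x m) = 0 := by
    intro n hn
    refine gont_local g hg nk hmono A B hA hB hcl x hx n (fun i _ => hzero i) (2 * δ)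
      (by positivity) hAr (x m) (hx m) (fun p => ?_)
    obtain ⟨q, rfl⟩ := Nat.exists_eq_add_of_le hn
    have h1 := hdist q
    have h2 := hm (m + q) hn p
    linarith
  have hstep : ∀ c ∈ Icc a b, (∀ n, m ≤ n → g n c = 0) → ∀ t ∈ Icc a b, |t - c| ≤ δ →
      ∀ n, m ≤ n → g n t = 0 := by
    intro c hc hcz t ht htc n hn
    refine gont_local g hg nk hmono A B hA hB hcl (fun _ => c) (fun _ => hc) n
      (fun i hi => hcz i (hn.trans hi)) (2 * δ) (by positivity) hAr t ht (fun p => ?_)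
    simp only [sub_self, abs_zero, Finset.sum_const_zero, add_zero]
    linarith
  have hall : ∀ k : ℕ, ∀ t ∈ Icc a b, |t - x m| ≤ k * δ → ∀ n, m ≤ n → g n t = 0 := by
    intro k
    induction k with
    | zero =>
      intro t ht h
      have : t = x m := by
        have : |t - x m| ≤ 0 := by simpa using h
        exact sub_eq_zero.1 (abs_eq_zero.1 (le_antisymm this (abs_nonneg _)))
      rw [this]; exact hstart
    | succ k ih =>
      intro t ht h
      have hk : (0 : ℝ) < (k : ℝ) + 1 := by positivity
      set u : ℝ := k / (k + 1) with hu
      have hu0 : 0 ≤ u := by positivity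
      have hu1 : 1 - u = 1 / (k + 1) := by rw [hu]; field_simp; ring
      have hu1' : u ≤ 1 := by
        have : 0 ≤ 1 - u := by rw [hu1]; positivity
        linarith
      push_cast at h
      have hc : x m + u * (t - x m) ∈ Icc a b := by
        have := (convex_Icc a b).add_smul_sub_mem (hx m) ht ⟨hu0, hu1'⟩
        simpa using this
      refine hstep _ hc (ih _ hc ?_) t ht ?_
      · rw [show x m + u * (t - x m) - x m = u * (t - x m) by ring, abs_mul, abs_of_nonneg hu0]
        calc u * |t - x m| ≤ u * ((k + 1) * δ) := by gcongr
          _ = k * δ := by rw [hu]; field_simp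
      · rw [show t - (x m + u * (t - x m)) = (1 - u) * (t - x m) by ring, abs_mul, hu1,
          abs_of_pos (by positivity : (0 : ℝ) < 1 / (k + 1))]
        calc 1 / ((k : ℝ) + 1) * |t - x m| ≤ 1 / ((k : ℝ) + 1) * ((k + 1) * δ) := by gcongr
          _ = δ := by field_simp
  have hgm : ∀ t ∈ Icc a b, g m t = 0 := by
    intro t ht
    obtain ⟨k, hk⟩ := exists_nat_ge (|t - x m| / δ)
    exact hall k t ht ((div_le_iff₀ hδ0).1 hk) m le_rfl
  intro t ht
  have h := gont_core g hg x hx 0 m 0 (fun i _ => hzero _)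
    (fun s hs => by rw [zero_add, hgm s hs, abs_zero]) t ht
  rw [zero_mul, zero_div] at h
  have h0 := abs_eq_zero.1 (le_antisymm h (abs_nonneg _))
  simpa [hgdef] using h0
end

section
/- Let m : [b₀,∞) → ℝ be C^∞ with m(t) > 0, m'(t) > 0, m''(t) > 0 for t ≫ 0, lim_{t→∞} m'(t) = ∞, and m''(t) ≤ δ for some δ > 0 and all t ≫ 0; set M(t) = e^{m(t)}. Fix t₀ > 0 and define Λ(r) = inf_{t ≥ t₀} M(t)/r^t and λ(r) = inf_{n ∈ ℕ, n ≥ t₀} M(n)/r^n for r > 0. Then for all sufficiently large r: e^{-δ}·λ(r) ≤ Λ(r) ≤ λ(r). -/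
open Set Filter

/-- Comparison between the continuous infimum `Λ(r) = inf_{t ≥ t₀} M(t)/r^t` and the
discrete infimum `λ(r) = inf_{n ∈ ℕ, n ≥ t₀} M(n)/rⁿ`: for all sufficiently large `r`,
`e^{-δ}·λ(r) ≤ Λ(r) ≤ λ(r)`. -/
theorem continuous_vs_discrete_infimum
    (b₀ δ : ℝ) (hδ : 0 < δ)
    (m : ℝ → ℝ) (hm : ContDiffOn ℝ (⊤ : ℕ∞) m (Set.Ici b₀))
    (hpos : ∀ᶠ t in atTop, 0 < m t ∧ 0 < deriv m t ∧ 0 < deriv (deriv m) t)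
    (hderiv : Filter.Tendsto (deriv m) Filter.atTop Filter.atTop)
    (hsecond : ∀ᶠ t in atTop, deriv (deriv m) t ≤ δ)
    (M : ℝ → ℝ) (hM : ∀ t, M t = Real.exp (m t))
    (t₀ : ℝ) (ht₀ : 0 < t₀) (hb₀t₀ : b₀ ≤ t₀)
    (Lam lam : ℝ → ℝ)
    (hLam : ∀ r : ℝ, Lam r = ⨅ t : {t : ℝ // t₀ ≤ t}, M t / Real.rpow r t)
    (hlam : ∀ r : ℝ, lam r = ⨅ n : {n : ℕ // t₀ ≤ ((n : ℕ) : ℝ)},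
        M ((n : ℕ) : ℝ) / r ^ (n : ℕ)) :
    ∀ᶠ r in atTop, Real.exp (-δ) * lam r ≤ Lam r ∧ Lam r ≤ lam r := by
  have hmo : ContDiffOn ℝ (⊤ : ℕ∞) m (Set.Ioi b₀) := hm.mono Ioi_subset_Ici_self
  have hd1 : DifferentiableOn ℝ m (Set.Ioi b₀) := hmo.differentiableOn (by simp)
  have hd2 : DifferentiableOn ℝ (deriv m) (Set.Ioi b₀) := by
    have h := hmo.deriv_of_isOpen (m := 1) isOpen_Ioi (by
      norm_cast)
    exact h.differentiableOn (by simp)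
  obtain ⟨T₁, hT₁⟩ := eventually_atTop.1 hsecond
  obtain ⟨T, hTT₁, hTt₀⟩ : ∃ T, T₁ ≤ T ∧ t₀ + 1 ≤ T := ⟨max T₁ (t₀ + 1), le_max_left _ _, le_max_right _ _⟩
  have hdm : ∀ x, T ≤ x → DifferentiableAt ℝ m x := fun x hx =>
    (hd1 x (by simp only [mem_Ioi]; linarith)).differentiableAt (Ioi_mem_nhds (by linarith))
  have hddm : ∀ x, T ≤ x → DifferentiableAt ℝ (deriv m) x := fun x hx =>
    (hd2 x (by simp only [mem_Ioi]; linarith)).differentiableAt (Ioi_mem_nhds (by linarith))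
  have hlip : ∀ x y, T ≤ x → x ≤ y → deriv m y - deriv m x ≤ δ * (y - x) := by
    intro x y hx hxy
    refine (convex_Ici T).image_sub_le_mul_sub_of_deriv_le
      (fun z hz => (hddm z hz).continuousAt.continuousWithinAt)
      (fun z hz => (hddm z (interior_subset hz)).differentiableWithinAt)
      (fun z hz => hT₁ z (hTT₁.trans (interior_subset hz))) x hx y (hx.trans hxy) hxy
  have hmv : ∀ x y, T ≤ x → x < y → ∃ c, x < c ∧ c < y ∧ m y - m x = deriv m c * (y - x) := by
    intro x y hx hxy
    obtain ⟨c, hc, h⟩ := exists_deriv_eq_slope m hxy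
      (fun z hz => (hdm z (hx.trans hz.1)).continuousAt.continuousWithinAt)
      (fun z hz => (hdm z (hx.trans hz.1.le)).differentiableWithinAt)
    refine ⟨c, hc.1, hc.2, ?_⟩
    have : y - x ≠ 0 := by linarith
    rw [h]; field_simp
  obtain ⟨C, hC⟩ : ∃ C, ∀ t ∈ Icc t₀ T, C ≤ m t := by
    obtain ⟨C, hC⟩ := (isCompact_Icc (a := t₀) (b := T)).bddBelow_image
      (hm.continuousOn.mono (fun z hz => hb₀t₀.trans hz.1))
    exact ⟨C, fun t ht => hC (mem_image_of_mem _ ht)⟩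
  obtain ⟨N, hN⟩ := exists_nat_ge (T + 1)
  have key : ∀ L : ℝ, 0 ≤ L → m N - C ≤ L → deriv m T + δ ≤ L → ∀ t, t₀ ≤ t →
      ∃ n : ℕ, t₀ ≤ (n : ℝ) ∧ m n - n * L - δ ≤ m t - t * L := by
    intro L hL0 hL1 hL2 t ht
    rcases le_total t T with htT | htT
    · refine ⟨N, by linarith, ?_⟩
      have h1 := hC t ⟨ht, htT⟩
      nlinarith [mul_le_mul_of_nonneg_right (show (1 : ℝ) ≤ N - t by linarith) hL0]
    · rcases le_or_gt (deriv m t) L with h | h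
      · have h1 := Nat.le_ceil t
        have h2 := Nat.ceil_lt_add_one (show 0 ≤ t by linarith)
        refine ⟨⌈t⌉₊, by linarith, ?_⟩
        generalize ((⌈t⌉₊ : ℕ) : ℝ) = n at *
        rcases h1.eq_or_lt with h1 | h1
        · subst h1; linarith
        · obtain ⟨c, hc1, hc2, hc⟩ := hmv t n htT h1
          have h3 := hlip t c htT hc1.le
          have h4 : deriv m c - L ≤ δ := by nlinarith
          nlinarith
      · have h1 := Nat.floor_le (show 0 ≤ t by linarith)
        have h2 := Nat.lt_floor_add_one t
        have hT1 : T + 1 < t := by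
          by_contra hcon
          have := hlip T t le_rfl htT
          nlinarith
        refine ⟨⌊t⌋₊, by linarith, ?_⟩
        generalize ((⌊t⌋₊ : ℕ) : ℝ) = n at *
        rcases h1.eq_or_lt with h1 | h1
        · subst h1; linarith
        · obtain ⟨c, hc1, hc2, hc⟩ := hmv n t (by linarith) h1
          have h3 := hlip c t (by linarith) hc2.le
          have h4 : -δ ≤ deriv m c - L := by nlinarith
          nlinarith
  filter_upwards [eventually_gt_atTop 0, Real.tendsto_log_atTop.eventually_ge_atTop 0,
    Real.tendsto_log_atTop.eventually_ge_atTop (m N - C),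
    Real.tendsto_log_atTop.eventually_ge_atTop (deriv m T + δ)] with r hr hL0 hL1 hL2
  have e1 : ∀ t : ℝ, M t / Real.rpow r t = Real.exp (m t - t * Real.log r) := by
    intro t
    rw [hM, Real.exp_sub, mul_comm t, ← Real.rpow_def_of_pos hr]; rfl
  have e2 : ∀ n : ℕ, M n / r ^ n = Real.exp (m n - n * Real.log r) := by
    intro n
    rw [← e1, ← Real.rpow_natCast]; rfl
  rw [hLam, hlam]
  simp only [e1, e2]
  have : Nonempty {t : ℝ // t₀ ≤ t} := ⟨⟨t₀, le_rfl⟩⟩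
  have : Nonempty {n : ℕ // t₀ ≤ ((n : ℕ) : ℝ)} := ⟨⟨N, by linarith⟩⟩
  constructor
  · refine le_ciInf fun ⟨t, ht⟩ => ?_
    obtain ⟨n, hn, h⟩ := key (Real.log r) hL0 hL1 hL2 t ht
    have h1 : (⨅ n : {n : ℕ // t₀ ≤ ((n : ℕ) : ℝ)},
        Real.exp (m ((n : ℕ) : ℝ) - (n : ℕ) * Real.log r)) ≤ Real.exp (m n - n * Real.log r) :=
      ciInf_le (f := fun n : {n : ℕ // t₀ ≤ ((n : ℕ) : ℝ)} =>
        Real.exp (m ((n : ℕ) : ℝ) - (n : ℕ) * Real.log r))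
        ⟨0, by rintro _ ⟨x, rfl⟩; positivity⟩ ⟨n, hn⟩
    refine (mul_le_mul_of_nonneg_left h1 (Real.exp_pos _).le).trans ?_
    rw [← Real.exp_add]
    exact Real.exp_le_exp.2 (by linarith)
  · refine le_ciInf fun ⟨n, hn⟩ => ?_
    exact ciInf_le (f := fun t : {t : ℝ // t₀ ≤ t} =>
        Real.exp (m t - t * Real.log r))
        ⟨0, by rintro _ ⟨x, rfl⟩; positivity⟩ ⟨(n : ℝ), hn⟩
end

section
/- Let m : [b₀,∞) → ℝ be C^∞ with m(t) > 0, m'(t) > 0, m''(t) > 0 for t ≫ 0, lim_{t→∞} m'(t) = ∞, and m''(t) ≤ δ for some δ > 0 and all t ≫ 0; set M(t) = e^{m(t)}, fix t₀ > 0, and define ω(r) = −log Λ(r), where Λ(r) = inf_{t ≥ t₀} M(t)/r^t (equivalently ω(r) = sup_{t ≥ t₀}(t·log r − m(t))). If there exist c > 0 and A > 0 such that ω(r) ≥ c·r for all r ≥ A, then every function f in the class C_M([a,b]) is real-analytic on [a,b]. -/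
open Set Filter

/-- `f` belongs to the class `C_M([a,b])`: `f` is `C^∞` on `[a,b]` and there exist
`C, ρ > 0` with `|f^(n)(t)| ≤ C·ρⁿ·M(n)` for all sufficiently large `n` and all
`t ∈ [a,b]`. -/
def MWeightClass (M : ℝ → ℝ) (a b : ℝ) (f : ℝ → ℝ) : Prop :=
  ContDiffOn ℝ (⊤ : ℕ∞) f (Set.Icc a b) ∧
  ∃ C > (0 : ℝ), ∃ ρ > (0 : ℝ), ∀ᶠ n : ℕ in Filter.atTop,
    ∀ t ∈ Set.Icc a b, |iteratedDerivWithin n f (Set.Icc a b) t| ≤ C * ρ ^ n * M n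

theorem aux_analytic (a b : ℝ) (hab : a < b) (f : ℝ → ℝ)
    (hf : ContDiffOn ℝ (⊤ : ℕ∞) f (Set.Icc a b)) (C K : ℝ) (hC : 0 < C) (hK : 0 < K)
    (h : ∀ᶠ n : ℕ in Filter.atTop, ∀ t ∈ Set.Icc a b,
      |iteratedDerivWithin n f (Set.Icc a b) t| ≤ C * K ^ n * (n.factorial : ℝ)) :
    AnalyticOn ℝ f (Set.Icc a b) := by
  intro x hx
  set p : FormalMultilinearSeries ℝ ℝ ℝ := FormalMultilinearSeries.ofScalars ℝ
    (fun n => iteratedDerivWithin n f (Set.Icc a b) x / (n.factorial : ℝ)) with hp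
  have hcoef : ∀ᶠ n : ℕ in Filter.atTop,
      |iteratedDerivWithin n f (Set.Icc a b) x / (n.factorial : ℝ)| ≤ C * K ^ n := by
    filter_upwards [h] with n hn
    have hpos : (0 : ℝ) < n.factorial := by exact_mod_cast n.factorial_pos
    rw [abs_div, abs_of_pos hpos, div_le_iff₀ hpos]
    exact hn x hx
  have hKi : 0 < K⁻¹ := inv_pos.mpr hK
  obtain ⟨R, hR⟩ : ∃ R : NNReal, (R : ℝ) = K⁻¹ := ⟨⟨K⁻¹, hKi.le⟩, rfl⟩
  refine ⟨p, (R : ENNReal), ?_, ?_, ?_⟩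
  · apply p.le_radius_of_eventually_le C
    filter_upwards [hcoef] with n hn
    rw [hp, FormalMultilinearSeries.ofScalars_norm, hR, Real.norm_eq_abs]
    calc _ ≤ (C * K ^ n) * (K⁻¹) ^ n := by
          apply mul_le_mul_of_nonneg_right hn
          positivity
      _ = C := by
          rw [mul_assoc, ← mul_pow, mul_inv_cancel₀ hK.ne', one_pow, mul_one]
  · rw [← hR] at hKi
    exact_mod_cast hKi
  · intro y hy hyr
    have hxy : x + y ∈ Set.Icc a b := by
      rcases hy with hy | hy
      · rw [hy]; exact hx
      · exact hy
    have hyK : K * |y| < 1 := by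
      rw [Metric.mem_eball, edist_zero_right] at hyr
      have h1 : ‖y‖₊ < R := by exact_mod_cast hyr
      have h2 : |y| < K⁻¹ := by rw [← hR]; exact h1
      calc K * |y| < K * K⁻¹ := by gcongr
        _ = 1 := mul_inv_cancel₀ hK.ne'
    have hKy0 : 0 ≤ K * |y| := by positivity
    have hterm : ∀ n : ℕ, (p n fun _ : Fin n => y) =
        iteratedDerivWithin n f (Set.Icc a b) x / (n.factorial : ℝ) * y ^ n := by
      intro n
      rw [hp, FormalMultilinearSeries.ofScalars_apply_eq]
      simp
    simp only [hterm]
    have hgeo : Summable (fun n : ℕ => C * (K * |y|) ^ n) :=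
      (summable_geometric_of_lt_one hKy0 hyK).mul_left C
    have hsum : Summable (fun n : ℕ =>
        iteratedDerivWithin n f (Set.Icc a b) x / (n.factorial : ℝ) * y ^ n) := by
      apply Summable.of_norm_bounded_eventually_nat hgeo
      filter_upwards [hcoef] with n hn
      rw [Real.norm_eq_abs, abs_mul, abs_pow, mul_pow, ← mul_assoc]
      gcongr
    rw [hsum.hasSum_iff_tendsto_nat, ← tendsto_add_atTop_iff_nat 1]
    rcases eq_or_ne y 0 with rfl | hy0
    · have : ∀ n : ℕ, ∑ i ∈ Finset.range (n + 1),
          iteratedDerivWithin i f (Set.Icc a b) x / (i.factorial : ℝ) * (0:ℝ) ^ i = f (x + 0) := by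
        intro n
        rw [Finset.sum_range_succ']
        simp
      simp only [this]
      exact tendsto_const_nhds
    have hne : x ≠ x + y := by simpa using hy0
    have hsub : Set.uIcc x (x + y) ⊆ Set.Icc a b := Set.uIcc_subset_Icc hx hxy
    have hu : UniqueDiffOn ℝ (Set.uIcc x (x + y)) := uniqueDiffOn_Icc (by simpa using hne)
    have hu' : UniqueDiffOn ℝ (Set.Icc a b) := uniqueDiffOn_Icc hab
    have hD : ∀ n : ℕ, ∀ z ∈ Set.uIcc x (x + y), iteratedDerivWithin n f (Set.uIcc x (x + y)) z
        = iteratedDerivWithin n f (Set.Icc a b) z := by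
      intro n z hz
      rw [iteratedDerivWithin, iteratedDerivWithin,
        iteratedFDerivWithin_subset hsub hu hu' (hf.of_le (by exact_mod_cast le_top)) hz]
    rw [tendsto_iff_norm_sub_tendsto_zero]
    have hg0 : Tendsto (fun n : ℕ => C * (K * |y|) ^ (n + 1)) atTop (nhds 0) :=
      (tendsto_add_atTop_iff_nat (f := fun n : ℕ => C * (K * |y|) ^ n) 1).2 hgeo.tendsto_atTop_zero
    refine squeeze_zero' (Eventually.of_forall fun n => norm_nonneg _) ?_ hg0
    filter_upwards [(tendsto_add_atTop_nat 1).eventually h] with n hn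
    obtain ⟨z, hz, hzE⟩ := taylor_mean_remainder_lagrange (n := n) (f := f) hne
      ((hf.mono hsub).of_le (by exact_mod_cast le_top))
      (((hf.mono hsub).differentiableOn_iteratedDerivWithin
        (by exact_mod_cast ENat.natCast_lt_top n) hu).mono Set.uIoo_subset_uIcc_self)
    have hz' : z ∈ Set.uIcc x (x + y) := Set.uIoo_subset_uIcc_self hz
    have hT : taylorWithinEval f n (Set.uIcc x (x + y)) x (x + y) = ∑ i ∈ Finset.range (n + 1),
        iteratedDerivWithin i f (Set.Icc a b) x / (i.factorial : ℝ) * y ^ i := by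
      rw [taylor_within_apply]
      apply Finset.sum_congr rfl
      intro i _
      rw [hD i x Set.left_mem_uIcc, add_sub_cancel_left, smul_eq_mul]
      ring
    rw [hT, hD _ z hz', add_sub_cancel_left] at hzE
    rw [norm_sub_rev, hzE, Real.norm_eq_abs, abs_div, abs_mul, abs_pow, Nat.abs_cast,
      div_le_iff₀ (by exact_mod_cast Nat.factorial_pos _)]
    calc _ ≤ (C * K ^ (n+1) * ((n+1).factorial : ℝ)) * |y| ^ (n+1) := by
          gcongr
          exact hn z (hsub hz')
      _ = _ := by rw [mul_pow]; ring

/-- If `ω(r) = −log Λ(r)`, with `Λ(r) = inf_{t ≥ t₀} M(t)/r^t`, grows at least linearly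
(`ω(r) ≥ c·r` for `r ≥ A`), then every `f ∈ C_M([a,b])` is real-analytic on `[a,b]`. -/
theorem analytic_of_linear_growth_trace
    (b₀ δ : ℝ) (hδ : 0 < δ)
    (m : ℝ → ℝ) (hm : ContDiffOn ℝ (⊤ : ℕ∞) m (Set.Ici b₀))
    (hpos : ∀ᶠ t in atTop, 0 < m t ∧ 0 < deriv m t ∧ 0 < deriv (deriv m) t)
    (hderiv : Filter.Tendsto (deriv m) Filter.atTop Filter.atTop)
    (hsecond : ∀ᶠ t in atTop, deriv (deriv m) t ≤ δ)
    (M : ℝ → ℝ) (hM : ∀ t, M t = Real.exp (m t))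
    (t₀ : ℝ) (ht₀ : 0 < t₀) (hb₀t₀ : b₀ ≤ t₀)
    (ω : ℝ → ℝ)
    (hω : ∀ r : ℝ, 0 < r →
        ω r = - Real.log (⨅ t : {t : ℝ // t₀ ≤ t}, M t / Real.rpow r t))
    (c A : ℝ) (hc : 0 < c) (hA : 0 < A)
    (hgrowth : ∀ r : ℝ, A ≤ r → c * r ≤ ω r)
    (a b : ℝ) (hab : a < b)
    (f : ℝ → ℝ) (hf : MWeightClass M a b f) :
    AnalyticOn ℝ f (Set.Icc a b) := by
  obtain ⟨hfs, C, hC, ρ, hρ, hbd⟩ := hf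
  -- smoothness of m in the interior
  have hsm : ContDiffOn ℝ (⊤ : ℕ∞) m (Set.Ioi b₀) := hm.mono Set.Ioi_subset_Ici_self
  have hsd : ContDiffOn ℝ (⊤ : ℕ∞) (deriv m) (Set.Ioi b₀) :=
    hsm.deriv_of_isOpen isOpen_Ioi (by simp)
  obtain ⟨T₁, hT₁⟩ := eventually_atTop.1 hpos
  obtain ⟨T, hTt₀, hTT₁⟩ : ∃ T, t₀ < T ∧ T₁ ≤ T :=
    ⟨max (t₀ + 1) T₁, lt_of_lt_of_le (by linarith) (le_max_left _ _), le_max_right _ _⟩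
  have hsub : Set.Ici T ⊆ Set.Ioi b₀ := fun t ht => by
    have : T ≤ t := ht
    show b₀ < t
    linarith
  have hdiff : ∀ t, T ≤ t → DifferentiableAt ℝ m t := fun t ht =>
    (hsm.differentiableOn (by simp)).differentiableAt (isOpen_Ioi.mem_nhds (hsub ht))
  have hconv : ConvexOn ℝ (Set.Ici T) m := by
    apply convexOn_of_deriv2_nonneg (convex_Ici T) (hsm.continuousOn.mono hsub)
    · exact (hsm.differentiableOn (by simp)).mono (interior_subset.trans hsub)
    · exact (hsd.differentiableOn (by simp)).mono (interior_subset.trans hsub)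
    · intro t ht
      exact (hT₁ t (hTT₁.trans (interior_subset ht))).2.2.le
  have htan : ∀ x, T ≤ x → ∀ t, T ≤ t → m x + deriv m x * (t - x) ≤ m t := by
    intro x hx t ht
    rcases lt_trichotomy x t with h | h | h
    · have := hconv.deriv_le_slope hx ht h (hdiff x hx)
      rw [slope_def_field, le_div_iff₀ (by linarith)] at this
      linarith
    · subst h; simp
    · have := hconv.slope_le_deriv ht hx h (hdiff x hx)
      rw [slope_def_field, div_le_iff₀ (by linarith)] at this
      linarith
  obtain ⟨B, hB⟩ : ∃ B : ℝ, ∀ t ∈ Set.Icc t₀ T, B ≤ m t := by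
    have hcont : ContinuousOn m (Set.Icc t₀ T) :=
      hm.continuousOn.mono (fun t ht => hb₀t₀.trans ht.1)
    obtain ⟨B, hB⟩ := (isCompact_Icc.image_of_continuousOn hcont).bddBelow
    exact ⟨B, fun t ht => hB (Set.mem_image_of_mem _ ht)⟩
  have hmain : ∀ᶠ x in atTop, m x ≤ x * deriv m x - c * Real.exp (deriv m x) := by
    filter_upwards [eventually_ge_atTop T,
      hderiv.eventually_ge_atTop (max (max 0 (Real.log A)) (m (T + 1) - B))] with x hx hs
    have hs0 : 0 ≤ deriv m x := (le_max_left _ _).trans ((le_max_left _ _).trans hs)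
    have hsA : Real.log A ≤ deriv m x := (le_max_right _ _).trans ((le_max_left _ _).trans hs)
    have hsB : m (T + 1) - B ≤ deriv m x := (le_max_right _ _).trans hs
    set s := deriv m x with hsdef
    have hall : ∀ t, t₀ ≤ t → m x - x * s ≤ m t - t * s := by
      intro t ht
      rcases le_total T t with h | h
      · have := htan x hx t h
        linarith
      · have h1 := htan x hx (T + 1) (by linarith)
        have h2 := hB t ⟨ht, h⟩
        have h3 : t * s ≤ T * s := mul_le_mul_of_nonneg_right h hs0
        linarith
    have hr : A ≤ Real.exp s := by
      rw [← Real.exp_log hA]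
      exact Real.exp_le_exp.2 hsA
    have hg := hgrowth _ hr
    rw [hω _ (Real.exp_pos s)] at hg
    have : Nonempty {t : ℝ // t₀ ≤ t} := ⟨⟨t₀, le_rfl⟩⟩
    have hinf : Real.exp (m x - x * s) ≤
        ⨅ t : {t : ℝ // t₀ ≤ t}, M t / Real.rpow (Real.exp s) t := by
      apply le_ciInf
      rintro ⟨t, ht⟩
      have e : Real.rpow (Real.exp s) t = Real.exp (t * s) := by
        show (Real.exp s) ^ t = _
        rw [← Real.exp_mul, mul_comm]
      show _ ≤ M t / Real.rpow (Real.exp s) t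
      rw [e, hM, ← Real.exp_sub]
      exact Real.exp_le_exp.2 (hall t ht)
    have hlog := Real.log_le_log (Real.exp_pos _) hinf
    rw [Real.log_exp] at hlog
    linarith
  have hMn : ∀ᶠ n : ℕ in atTop, M n ≤ (c⁻¹) ^ n * (n.factorial : ℝ) := by
    filter_upwards [tendsto_natCast_atTop_atTop.eventually hmain] with n hn
    set s := deriv m (n : ℝ)
    have hfac : (0 : ℝ) < n.factorial := by exact_mod_cast n.factorial_pos
    have h1 := Real.pow_div_factorial_le_exp _ (mul_pos hc (Real.exp_pos s)).le n
    rw [div_le_iff₀ hfac, mul_pow, ← Real.exp_nat_mul] at h1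
    have h2 : M n ≤ Real.exp (n * s) / Real.exp (c * Real.exp s) := by
      rw [hM, ← Real.exp_sub]
      exact Real.exp_le_exp.2 hn
    refine h2.trans ?_
    rw [div_le_iff₀ (Real.exp_pos _), inv_pow, mul_assoc, inv_mul_eq_div,
      le_div_iff₀ (pow_pos hc n)]
    linarith
  refine aux_analytic a b hab f hfs C (ρ * c⁻¹) hC (by positivity) ?_
  filter_upwards [hbd, hMn] with n h1 h2 t ht
  refine (h1 t ht).trans ?_
  rw [mul_pow]
  calc C * ρ ^ n * M n ≤ C * ρ ^ n * ((c⁻¹) ^ n * (n.factorial : ℝ)) := by gcongr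
    _ = _ := by ring
end

section
/- Let m(t) = t·log t + t·log(log t) for large t and M(t) = e^{m(t)} = t^t·(log t)^t. Then the class C_M([a,b]) is quasianalytic: every C^∞ function f on [a,b] for which there exist C > 0, ρ > 0 with |f^{(n)}(t)| ≤ C·ρ^n·M(n) for all sufficiently large n and all t ∈ [a,b], and which satisfies f^{(n)}(c) = 0 for all n ∈ ℕ at some point c ∈ [a,b], is identically zero on [a,b]. -/
open Set Filter

lemma bang_step (G : ℕ → ℝ → ℝ) (M μ : ℕ → ℝ) (hM : ∀ n, 0 < M n) (hμ : ∀ n, 0 < μ n)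
    (hmono : Monotone μ) (hMs : ∀ n, M (n + 1) = μ n * M n)
    (hG : ∀ n, ∀ t ∈ Icc (0 : ℝ) 1, HasDerivWithinAt (G n) (G (n + 1) t) (Icc 0 1) t)
    (hb : ∀ n, ∀ t ∈ Icc (0 : ℝ) 1, |G n t| ≤ M n)
    (N : ℕ) (x y : ℝ) (hx : x ∈ Icc (0 : ℝ) 1) (hy : y ∈ Icc (0 : ℝ) 1) (hxy : x ≤ y)
    (hd : y - x ≤ 1 / (Real.exp 1 * μ N))
    (hP : ∀ j : ℕ, |G j x| ≤ Real.exp ((j : ℝ) - ((N + 1 : ℕ) : ℝ)) * M j) :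
    ∀ j : ℕ, |G j y| ≤ Real.exp ((j : ℝ) - (N : ℝ)) * M j := by
  set q : ℝ := Real.exp 1 * μ N with hq
  have hq0 : 0 < q := mul_pos (Real.exp_pos _) (hμ N)
  -- growth estimate, by induction downwards from `N + 1`
  have key : ∀ k j : ℕ, j + k = N + 1 → ∀ s ∈ Icc x y,
      |G j s| ≤ Real.exp ((j : ℝ) - ((N + 1 : ℕ) : ℝ)) * M j * Real.exp (q * (s - x)) := by
    intro k
    induction k with
    | zero =>
      intro j hj s hs
      have hj' : j = N + 1 := by omega
      subst hj'
      have h1 := hb (N + 1) s ⟨hx.1.trans hs.1, hs.2.trans hy.2⟩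
      have h2 : 1 ≤ Real.exp (q * (s - x)) :=
        Real.one_le_exp (mul_nonneg hq0.le (by linarith [hs.1]))
      rw [sub_self, Real.exp_zero, one_mul]
      nlinarith [hM (N + 1)]
    | succ k ih =>
      intro j hj
      have ih' := ih (j + 1) (by omega)
      set A : ℝ := Real.exp ((j : ℝ) - ((N + 1 : ℕ) : ℝ)) * M j with hA
      have hA0 : 0 < A := mul_pos (Real.exp_pos _) (hM j)
      have hsub : Icc x y ⊆ Icc (0 : ℝ) 1 := Icc_subset_Icc hx.1 hy.2
      have hderB : ∀ s : ℝ, HasDerivAt (fun s => A * Real.exp (q * (s - x)))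
          (A * (Real.exp (q * (s - x)) * q)) s := by
        intro s
        have h1 : HasDerivAt (fun s : ℝ => q * (s - x)) q s := by
          simpa using ((hasDerivAt_id s).sub_const x).const_mul q
        exact (h1.exp).const_mul A
      have := image_norm_le_of_norm_deriv_right_le_deriv_boundary (f := G j)
        (f' := fun t => G (j + 1) t) (a := x) (b := y)
        (B := fun s => A * Real.exp (q * (s - x)))
        (B' := fun s => A * (Real.exp (q * (s - x)) * q))
        (fun s hs => ((hG j s (hsub hs)).continuousWithinAt).mono hsub)
        (fun s hs => by
          have h := (hG j s (hsub ⟨hs.1, hs.2.le⟩)).mono hsub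
          refine h.mono_of_mem_nhdsWithin ?_
          exact Icc_mem_nhdsGE_of_mem hs)
        (by
          have h := hP j
          rw [← hA] at h
          simpa only [sub_self, mul_zero, Real.exp_zero, mul_one, Real.norm_eq_abs] using h) hderB
        (fun s hs => by
          have h := ih' s ⟨hs.1, hs.2.le⟩
          rw [Real.norm_eq_abs]
          refine h.trans ?_
          have e1 : Real.exp (((j + 1 : ℕ) : ℝ) - ((N + 1 : ℕ) : ℝ)) * M (j + 1)
              = A * (Real.exp 1 * μ j) := by
            rw [hA, hMs, show (((j + 1 : ℕ) : ℝ) - ((N + 1 : ℕ) : ℝ))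
              = ((j : ℝ) - ((N + 1 : ℕ) : ℝ)) + 1 by push_cast; ring, Real.exp_add]
            ring
          rw [e1]
          have h3 : μ j ≤ μ N := hmono (by omega)
          have h4 : Real.exp 1 * μ j ≤ q := mul_le_mul_of_nonneg_left h3 (Real.exp_pos _).le
          calc A * (Real.exp 1 * μ j) * Real.exp (q * (s - x))
              ≤ A * q * Real.exp (q * (s - x)) := by gcongr
            _ = _ := by ring)
      intro s hs
      simpa using this hs
  intro j
  rcases le_or_gt j (N + 1) with hj | hj
  · have h := key (N + 1 - j) j (by omega) y ⟨hxy, le_rfl⟩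
    have h2 : q * (y - x) ≤ 1 := by
      have := mul_le_mul_of_nonneg_left hd hq0.le
      rwa [mul_one_div_cancel hq0.ne'] at this
    refine h.trans ?_
    calc _ ≤ Real.exp ((j : ℝ) - ((N + 1 : ℕ) : ℝ)) * M j * Real.exp 1 := by
          have := (hM j).le
          gcongr
      _ = Real.exp (((j : ℝ) - ((N + 1 : ℕ) : ℝ)) + 1) * M j := by rw [Real.exp_add]; ring
      _ = _ := by congr 2; push_cast; ring
  · have h1 := hb j y hy
    have h2 : 1 ≤ Real.exp ((j : ℝ) - (N : ℝ)) := by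
      apply Real.one_le_exp
      have : (N : ℝ) ≤ j := by exact_mod_cast (by omega : N ≤ j)
      linarith
    nlinarith [hM j]

lemma bang_zero (G : ℕ → ℝ → ℝ) (M μ : ℕ → ℝ) (hM : ∀ n, 0 < M n) (hμ : ∀ n, 0 < μ n)
    (hmono : Monotone μ) (hMs : ∀ n, M (n + 1) = μ n * M n)
    (hG : ∀ n, ∀ t ∈ Icc (0 : ℝ) 1, HasDerivWithinAt (G n) (G (n + 1) t) (Icc 0 1) t)
    (hb : ∀ n, ∀ t ∈ Icc (0 : ℝ) 1, |G n t| ≤ M n)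
    (h0 : ∀ n, G n 0 = 0)
    (hdiv : Tendsto (fun n => ∑ k ∈ Finset.range n, 1 / (Real.exp 1 * μ k)) atTop atTop) :
    G 0 1 = 0 := by
  set S : ℕ → ℝ := fun n => ∑ k ∈ Finset.range n, 1 / (Real.exp 1 * μ k) with hS
  have hpos : ∀ k, 0 < 1 / (Real.exp 1 * μ k) := fun k =>
    one_div_pos.2 (mul_pos (Real.exp_pos _) (hμ k))
  have hSs : ∀ n, S (n + 1) = S n + 1 / (Real.exp 1 * μ n) := fun n => Finset.sum_range_succ _ _
  have hSm : Monotone S := monotone_nat_of_le_succ fun n => by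
    rw [hSs]; linarith [hpos n]
  have key : ∀ d N : ℕ, ∀ t ∈ Icc (0 : ℝ) 1, t ≤ S (N + d) - S N →
      ∀ j : ℕ, |G j t| ≤ Real.exp ((j : ℝ) - (N : ℝ)) * M j := by
    intro d
    induction d with
    | zero =>
      intro N t ht htS j
      have : t = 0 := le_antisymm (by simpa using htS) ht.1
      rw [this, h0, abs_zero]
      exact (mul_pos (Real.exp_pos _) (hM j)).le
    | succ d ih =>
      intro N t ht htS
      have hnn : 0 ≤ S (N + 1 + d) - S (N + 1) := sub_nonneg.2 (hSm (by omega))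
      have hx : min t (S (N + 1 + d) - S (N + 1)) ∈ Icc (0 : ℝ) 1 :=
        ⟨le_min ht.1 hnn, (min_le_left _ _).trans ht.2⟩
      refine bang_step G M μ hM hμ hmono hMs hG hb N _ t hx ht (min_le_left _ _) ?_
        (ih (N + 1) _ hx (min_le_right _ _))
      have e : N + (d + 1) = N + 1 + d := by omega
      rw [e] at htS
      have := hSs N
      rcases min_choice t (S (N + 1 + d) - S (N + 1)) with h | h <;> rw [h]
      · linarith [hpos N]
      · linarith
  have hall : ∀ N : ℕ, |G 0 1| ≤ Real.exp (-(N : ℝ)) * M 0 := by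
    intro N
    obtain ⟨K, hK⟩ := (tendsto_atTop_atTop.1 hdiv) (1 + S N)
    have h1 := hK (N + K) (by omega)
    have := key K N 1 ⟨zero_le_one, le_rfl⟩ (by change 1 + S N ≤ S (N + K) at h1; linarith) 0
    simpa using this
  have hlim : Tendsto (fun N : ℕ => Real.exp (-(N : ℝ)) * M 0) atTop (nhds (0 * M 0)) :=
    (Real.tendsto_exp_neg_atTop_nhds_zero.comp tendsto_natCast_atTop_atTop).mul_const _
  have := ge_of_tendsto' hlim hall
  rw [zero_mul] at this
  exact abs_eq_zero.1 (le_antisymm this (abs_nonneg _))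

lemma log_log_diff (x : ℝ) (hx : 1 < x) :
    Real.log (Real.log (x + 1)) - Real.log (Real.log x) ≤ 1 / (x * Real.log x) := by
  have hl : 0 < Real.log x := Real.log_pos hx
  have hl1 : 0 < Real.log (x + 1) := Real.log_pos (by linarith)
  have h1 : Real.log (x + 1) - Real.log x ≤ 1 / x := by
    rw [← Real.log_div (by linarith) (by linarith)]
    refine (Real.log_le_sub_one_of_pos (by positivity)).trans (le_of_eq ?_)
    field_simp
    ring
  rw [← Real.log_div hl1.ne' hl.ne']
  refine (Real.log_le_sub_one_of_pos (by positivity)).trans ?_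
  rw [div_sub_one hl.ne', ← div_div]
  gcongr

lemma div_sum (A : ℝ) (hA : 0 < A) :
    Tendsto (fun n => ∑ k ∈ Finset.range n,
      1 / (Real.exp 1 * (A * ((k : ℝ) + 1) * Real.log ((k : ℝ) + 2)))) atTop atTop := by
  have hlow : ∀ n : ℕ, (1 / (Real.exp 1 * A)) *
      (Real.log (Real.log ((n : ℝ) + 2)) - Real.log (Real.log 2)) ≤
      ∑ k ∈ Finset.range n, 1 / (Real.exp 1 * (A * ((k : ℝ) + 1) * Real.log ((k : ℝ) + 2))) := by
    intro n
    induction n with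
    | zero => simp
    | succ n ih =>
      rw [Finset.sum_range_succ]
      have hn : (0 : ℝ) ≤ n := Nat.cast_nonneg n
      have h := log_log_diff ((n : ℝ) + 2) (by linarith)
      have hl : 0 < Real.log ((n : ℝ) + 2) := Real.log_pos (by linarith)
      have h2 : 1 / (((n : ℝ) + 2) * Real.log ((n : ℝ) + 2))
          ≤ 1 / (((n : ℝ) + 1) * Real.log ((n : ℝ) + 2)) := by
        gcongr; norm_num
      have h3 := mul_le_mul_of_nonneg_left (h.trans h2)
        (by positivity : 0 ≤ 1 / (Real.exp 1 * A))
      have e : (1 / (Real.exp 1 * A)) * (1 / (((n : ℝ) + 1) * Real.log ((n : ℝ) + 2))) =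
          1 / (Real.exp 1 * (A * ((n : ℝ) + 1) * Real.log ((n : ℝ) + 2))) := by
        rw [one_div_mul_one_div]; congr 1; ring
      rw [e] at h3
      push_cast
      rw [show (n : ℝ) + 1 + 2 = n + 2 + 1 by ring]
      nlinarith
  refine tendsto_atTop_mono hlow ?_
  refine Tendsto.const_mul_atTop (by positivity) ?_
  refine tendsto_atTop_add_const_right _ _ ?_
  exact Real.tendsto_log_atTop.comp (Real.tendsto_log_atTop.comp
    (tendsto_atTop_add_const_right _ _ tendsto_natCast_atTop_atTop))

lemma exponent_step (n : ℕ) (hn : 3 ≤ n) :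
    ((n + 1 : ℕ) : ℝ) * Real.log ((n + 1 : ℕ) : ℝ)
        + ((n + 1 : ℕ) : ℝ) * Real.log (Real.log ((n + 1 : ℕ) : ℝ)) ≤
      2 + Real.log ((n : ℝ) + 1) + Real.log (Real.log ((n : ℝ) + 2)) +
      ((n : ℝ) * Real.log n + (n : ℝ) * Real.log (Real.log n)) := by
  have hn' : (3 : ℝ) ≤ n := by exact_mod_cast hn
  have hn0 : (0 : ℝ) < n := by linarith
  have hl : 1 ≤ Real.log n := by
    rw [Real.le_log_iff_exp_le hn0]
    linarith [Real.exp_one_lt_d9]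
  have h1 : (n : ℝ) * (Real.log ((n : ℝ) + 1) - Real.log n) ≤ 1 := by
    have : Real.log ((n : ℝ) + 1) - Real.log n ≤ 1 / n := by
      rw [← Real.log_div (by linarith) (by linarith)]
      refine (Real.log_le_sub_one_of_pos (by positivity)).trans (le_of_eq ?_)
      field_simp
      ring
    have := mul_le_mul_of_nonneg_left this hn0.le
    rwa [mul_one_div_cancel hn0.ne'] at this
  have h2 : (n : ℝ) * (Real.log (Real.log ((n : ℝ) + 1)) - Real.log (Real.log n)) ≤ 1 := by
    have h := log_log_diff n (by linarith)
    have h' : 1 / ((n : ℝ) * Real.log n) ≤ 1 / n := by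
      apply one_div_le_one_div_of_le hn0
      nlinarith
    have := mul_le_mul_of_nonneg_left (h.trans h') hn0.le
    rwa [mul_one_div_cancel hn0.ne'] at this
  have h3 : Real.log (Real.log ((n : ℝ) + 1)) ≤ Real.log (Real.log ((n : ℝ) + 2)) := by
    have : 0 < Real.log ((n : ℝ) + 1) := Real.log_pos (by linarith)
    gcongr
    norm_num
  push_cast
  nlinarith

/-- The class associated with `M(t) = e^{t·log t + t·log(log t)} = t^t·(log t)^t` is
quasianalytic: if `f` is `C^∞` on `[a,b]`, there are `C, ρ > 0` with
`|f^(n)(t)| ≤ C·ρⁿ·M(n)` for all sufficiently large `n` and all `t ∈ [a,b]`, and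
`f^(n)(c) = 0` for all `n` at some `c ∈ [a,b]`, then `f ≡ 0` on `[a,b]`. -/
theorem quasianalytic_t_log_t_log_log_t
    (a b : ℝ) (hab : a < b)
    (f : ℝ → ℝ) (hf : ContDiffOn ℝ (⊤ : ℕ∞) f (Set.Icc a b))
    (hclass : ∃ C > (0 : ℝ), ∃ ρ > (0 : ℝ), ∀ᶠ n : ℕ in Filter.atTop,
        ∀ t ∈ Set.Icc a b,
          |iteratedDerivWithin n f (Set.Icc a b) t|
            ≤ C * ρ ^ n * Real.exp ((n : ℝ) * Real.log (n : ℝ)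
                + (n : ℝ) * Real.log (Real.log (n : ℝ))))
    (c : ℝ) (hc : c ∈ Set.Icc a b)
    (hzero : ∀ n : ℕ, iteratedDerivWithin n f (Set.Icc a b) c = 0) :
    ∀ x ∈ Set.Icc a b, f x = 0 := by
  obtain ⟨C, hC, ρ, hρ, hev⟩ := hclass
  obtain ⟨n₁, hn₁⟩ := eventually_atTop.1 hev
  set n₀ := max n₁ 3 with hn₀
  set F : ℕ → ℝ → ℝ := fun n => iteratedDerivWithin n f (Icc a b) with hF
  have hud : UniqueDiffOn ℝ (Icc a b) := uniqueDiffOn_Icc hab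
  have hFd : ∀ n, ∀ t ∈ Icc a b, HasDerivWithinAt (F n) (F (n + 1) t) (Icc a b) t := by
    intro n t ht
    have h := hf.differentiableOn_iteratedDerivWithin (m := n)
      (by exact_mod_cast WithTop.coe_lt_top n) hud t ht
    have := h.hasDerivWithinAt
    rwa [← iteratedDerivWithin_succ] at this
  set ν : ℕ → ℝ := fun k => (ρ * Real.exp 2) * ((k : ℝ) + 1) * Real.log ((k : ℝ) + 2) with hν
  have hlogpos : ∀ k : ℕ, 0 < Real.log ((k : ℝ) + 2) := fun k =>
    Real.log_pos (by have : (0 : ℝ) ≤ k := Nat.cast_nonneg k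
                     linarith)
  have hνpos : ∀ k, 0 < ν k := fun k => by
    have := hlogpos k
    simp only [hν]; positivity
  set Q : ℕ → ℝ := fun n => ∏ k ∈ Finset.range n, ν k with hQ
  have hQpos : ∀ n, 0 < Q n := fun n => Finset.prod_pos fun k _ => hνpos k
  have hQs : ∀ n, Q (n + 1) = Q n * ν n := fun n => Finset.prod_range_succ _ _
  set B : ℕ → ℝ := fun n => C * ρ ^ n * Real.exp ((n : ℝ) * Real.log (n : ℝ)
                + (n : ℝ) * Real.log (Real.log (n : ℝ))) with hB
  have hBpos : ∀ n, 0 < B n := fun n => by simp only [hB]; positivity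
  have hBs : ∀ n, 3 ≤ n → B (n + 1) ≤ B n * ν n := by
    intro n hn
    have h := Real.exp_le_exp.2 (exponent_step n hn)
    rw [Real.exp_add (2 + Real.log ((n : ℝ) + 1) + Real.log (Real.log ((n : ℝ) + 2))),
      Real.exp_add (2 + Real.log ((n : ℝ) + 1)), Real.exp_add 2,
      Real.exp_log (by positivity : (0 : ℝ) < (n : ℝ) + 1), Real.exp_log (hlogpos n)] at h
    simp only [hB, hν]
    calc _ ≤ C * ρ ^ (n + 1) * _ := mul_le_mul_of_nonneg_left h (by positivity)
      _ = _ := by rw [pow_succ]; ring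
  -- bounds for each derivative
  have hbd : ∀ n, ∃ E : ℝ, 0 ≤ E ∧ ∀ t ∈ Icc a b, |F n t| ≤ E * Q n := by
    intro n
    have hcont : ContinuousOn (F n) (Icc a b) := fun t ht => (hFd n t ht).continuousWithinAt
    obtain ⟨E, hE⟩ := isCompact_Icc.exists_bound_of_continuousOn hcont
    refine ⟨|E| / Q n, div_nonneg (abs_nonneg _) (hQpos n).le, fun t ht => ?_⟩
    rw [div_mul_cancel₀ _ (hQpos n).ne']
    exact (hE t ht).trans (le_abs_self E)
  choose E hE0 hE using hbd
  set D : ℝ := (∑ k ∈ Finset.range n₀, E k) + B n₀ / Q n₀ with hD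
  have hsum0 : 0 ≤ ∑ k ∈ Finset.range n₀, E k := Finset.sum_nonneg fun k _ => hE0 k
  have hDB : B n₀ / Q n₀ ≤ D := by linarith
  have hDpos : 0 < D := lt_of_lt_of_le (div_pos (hBpos _) (hQpos _)) hDB
  have hBD : ∀ n, n₀ ≤ n → B n ≤ D * Q n := by
    intro n hn
    induction n, hn using Nat.le_induction with
    | base => exact (div_le_iff₀ (hQpos _)).1 hDB
    | succ n hn ih =>
      have h3 : 3 ≤ n := (le_max_right _ _).trans hn
      calc _ ≤ B n * ν n := hBs n h3
        _ ≤ D * Q n * ν n := mul_le_mul_of_nonneg_right ih (hνpos n).le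
        _ = _ := by rw [hQs]; ring
  have hFb : ∀ n, ∀ t ∈ Icc a b, |F n t| ≤ D * Q n := by
    intro n t ht
    rcases lt_or_ge n n₀ with h | h
    · refine (hE n t ht).trans (mul_le_mul_of_nonneg_right ?_ (hQpos n).le)
      have h1 := Finset.single_le_sum (f := E) (fun k _ => hE0 k) (Finset.mem_range.2 h)
      have h2 := div_pos (hBpos n₀) (hQpos n₀)
      linarith
    · exact (hn₁ n ((le_max_left _ _).trans h) t ht).trans (hBD n h)
  intro x hx
  set R : ℝ := b - a with hR
  have hR0 : 0 < R := sub_pos.2 hab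
  have hL : |x - c| ≤ R := by
    rw [abs_le]; constructor <;> linarith [hx.1, hx.2, hc.1, hc.2]
  have hmaps : MapsTo (fun t : ℝ => c + t * (x - c)) (Icc 0 1) (Icc a b) := by
    intro t ht
    have h := (convex_Icc a b) hc hx (sub_nonneg.2 ht.2) ht.1 (by ring)
    have e : (1 - t) • c + t • x = c + t * (x - c) := by simp only [smul_eq_mul]; ring
    rwa [e] at h
  have hmain := bang_zero (fun n t => (x - c) ^ n * F n (c + t * (x - c)))
    (fun n => R ^ n * (D * Q n)) (fun n => R * ν n)
    (fun n => by have := hQpos n; positivity) (fun n => mul_pos hR0 (hνpos n))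
    (by
      intro i j hij
      have hij' : (i : ℝ) ≤ j := by exact_mod_cast hij
      have := hlogpos i
      simp only [hν]
      gcongr)
    (fun n => by rw [hQs, pow_succ]; ring)
    (fun n t ht => by
      have h1 : HasDerivWithinAt (fun t : ℝ => c + t * (x - c)) (x - c) (Icc 0 1) t := by
        simpa using (((hasDerivAt_id t).mul_const (x - c)).const_add c).hasDerivWithinAt
      have h2 := ((hFd n _ (hmaps ht)).comp t h1 hmaps).const_mul ((x - c) ^ n)
      refine h2.congr_deriv ?_
      rw [pow_succ]; ring)
    (fun n t ht => by
      rw [abs_mul, abs_pow]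
      have := hFb n _ (hmaps ht)
      gcongr)
    (fun n => by simp [hF, hzero n])
    (by
      have := div_sum (R * (ρ * Real.exp 2)) (by positivity)
      refine this.congr fun n => Finset.sum_congr rfl fun k _ => ?_
      simp only [hν]
      congr 2
      ring)
  simpa [hF] using hmain
end
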